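/- Let ⊕ be a sum of open sets in ℝ^d satisfying the six requirements exactly, and such that A ⊕ B is bulky for all bounded open A, B. Then for all bounded open sets A, B ⊆ ℝ^d, the set A ⊕ B is a quadrature domain for 1_A + 1_B: for every function s that is superharmonic and integrable on A ⊕ B, ∫_{A ⊕ B} s dλ ≤ ∫_A s dλ + ∫_B s dλ. -/

import Mathlib

open MeasureTheory Metric Bornology

/-- Points of `ℝ^d`. -/
abbrev Pt (d : ℕ) := EuclideanSpace ℝ (Fin d)

/-- A cubic isometry: a linear isometry of ℝ^d mapping the cube [−1,1]^d to itself. -/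
def CubicIsometry {d : ℕ} (U : Pt d ≃ₗᵢ[ℝ] Pt d) : Prop :=
  ⇑U '' {y : Pt d | ∀ i, |y i| ≤ 1} = {y : Pt d | ∀ i, |y i| ≤ 1}

/-- A bounded open set. -/
def GoodSet {d : ℕ} (A : Set (Pt d)) : Prop := IsOpen A ∧ Bornology.IsBounded A

/-- A sum of open sets satisfying the six requirements exactly: it sends bounded open
sets to open sets and is monotone, commutative, associative (when the intermediate sums
are bounded), translation invariant, invariant under cubic isometries, and conserves
Lebesgue measure. -/
structure SumAxioms (d : ℕ) (Φ : Set (Pt d) → Set (Pt d) → Set (Pt d)) : Prop where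
  isOpen : ∀ A B, GoodSet A → GoodSet B → IsOpen (Φ A B)
  subset_sum : ∀ A B, GoodSet A → GoodSet B → A ⊆ Φ A B
  mono : ∀ A B C, GoodSet A → GoodSet B → GoodSet C → A ⊆ B → Φ A C ⊆ Φ B C
  comm : ∀ A B, GoodSet A → GoodSet B → Φ A B = Φ B A
  assoc : ∀ A B C, GoodSet A → GoodSet B → GoodSet C →
      Bornology.IsBounded (Φ A B) → Bornology.IsBounded (Φ B C) →
      Φ (Φ A B) C = Φ A (Φ B C)
  translate : ∀ (A B : Set (Pt d)) (x : Pt d), GoodSet A → GoodSet B →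
      Φ ((· + x) '' A) ((· + x) '' B) = (· + x) '' (Φ A B)
  rotate : ∀ (A B : Set (Pt d)) (U : Pt d ≃ₗᵢ[ℝ] Pt d), CubicIsometry U →
      GoodSet A → GoodSet B → Φ (⇑U '' A) (⇑U '' B) = ⇑U '' (Φ A B)
  conserve : ∀ A B, GoodSet A → GoodSet B → volume (Φ A B) = volume A + volume B

/-- An open set is *bulky* if it contains every open set essentially equal to it
(i.e. whose symmetric difference with it has Lebesgue measure zero). -/
def Bulky {d : ℕ} (U : Set (Pt d)) : Prop :=
  IsOpen U ∧ ∀ V : Set (Pt d), IsOpen V → volume (symmDiff V U) = 0 → V ⊆ U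

/-- `bulk A` is the bulky open set essentially equal to an open set `A`: the union of all
open sets essentially contained in `A`. -/
def bulk {d : ℕ} (A : Set (Pt d)) : Set (Pt d) :=
  ⋃₀ {B : Set (Pt d) | IsOpen B ∧ volume (B \ A) = 0}

/-- `s`, with values in ℝ ∪ {−∞}, is superharmonic on the open set `Q`: it is lower
semicontinuous on `Q`, locally integrable on `Q` (in particular finite a.e. on `Q`, and
never `+∞` on `Q`), and for every `x ∈ Q` its average over all sufficiently small balls
centered at `x` is at most `s x`. -/
def SuperharmonicOn {d : ℕ} (s : Pt d → EReal) (Q : Set (Pt d)) : Prop :=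
  (∀ x ∈ Q, s x ≠ ⊤) ∧
  LowerSemicontinuousOn s Q ∧
  MeasureTheory.LocallyIntegrableOn (fun x => (s x).toReal) Q volume ∧
  (∀ᵐ x ∂(volume.restrict Q), s x ≠ ⊥) ∧
  ∀ x ∈ Q, ∃ r₀ > 0, ∀ r : ℝ, 0 < r → r < r₀ →
    ((⨍ y in Metric.ball x r, (s y).toReal ∂volume : ℝ) : EReal) ≤ s x

/-- `Q` is a quadrature domain for the weight `w ≥ 0`: `Q` is open, essentially contains
`{w > 0}`, and `∫_Q s ≤ ∫ s·w` for every `s` superharmonic and integrable on `Q`. -/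
def QuadratureDomain {d : ℕ} (w : Pt d → ℝ) (Q : Set (Pt d)) : Prop :=
  IsOpen Q ∧
  volume ({x | 0 < w x} \ Q) = 0 ∧
  ∀ s : Pt d → EReal, SuperharmonicOn s Q →
    MeasureTheory.IntegrableOn (fun x => (s x).toReal) Q volume →
    (∫ x in Q, (s x).toReal) ≤ ∫ x, (s x).toReal * w x

section
open MeasureTheory Metric Bornology

namespace SumQD

variable {d : ℕ}

/-- index type of signed permutations -/
abbrev G (d : ℕ) := Equiv.Perm (Fin d) × (Fin d → ℤˣ)

lemma unit_sq (u : ℤˣ) : ((u : ℤ) : ℝ) * ((u : ℤ) : ℝ) = 1 := by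
  rcases Int.units_eq_one_or u with h | h <;> simp [h]

/-- signed permutation as a linear isometry -/
noncomputable def sg (g : G d) : Pt d ≃ₗᵢ[ℝ] Pt d where
  toFun y := WithLp.toLp 2 (fun i => (((g.2 i : ℤˣ) : ℤ) : ℝ) * y (g.1 i))
  invFun y := WithLp.toLp 2
    (fun i => (((g.2 (g.1.symm i) : ℤˣ) : ℤ) : ℝ) * y (g.1.symm i))
  map_add' x y := by ext i; simp [mul_add]
  map_smul' c x := by ext i; simp; ring
  left_inv y := by
    ext i; simp [← mul_assoc, unit_sq]
  right_inv y := by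
    ext i; simp [← mul_assoc, unit_sq]
  norm_map' y := by
    rw [EuclideanSpace.norm_eq, EuclideanSpace.norm_eq]
    congr 1
    simp only [Real.norm_eq_abs, sq_abs]
    change ∑ i, ((((g.2 i : ℤˣ) : ℤ) : ℝ) * y (g.1 i)) ^ 2 = _
    simp only [mul_pow, sq (((g.2 _ : ℤˣ) : ℤ) : ℝ), unit_sq, one_mul]
    exact Equiv.sum_comp g.1 (fun i => y i ^ 2)

lemma sg_apply (g : G d) (y : Pt d) (i : Fin d) :
    sg g y i = (((g.2 i : ℤˣ) : ℤ) : ℝ) * y (g.1 i) := rfl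

lemma sg_symm_apply (g : G d) (y : Pt d) (i : Fin d) :
    (sg g).symm y i = (((g.2 (g.1.symm i) : ℤˣ) : ℤ) : ℝ) * y (g.1.symm i) := rfl

lemma unit_abs (u : ℤˣ) : |((u : ℤ) : ℝ)| = 1 := by
  rcases Int.units_eq_one_or u with h | h <;> simp [h]

lemma sg_cubic (g : G d) : CubicIsometry (sg g) := by
  unfold CubicIsometry
  ext y
  constructor
  · rintro ⟨z, hz, rfl⟩ i
    rw [sg_apply, abs_mul, unit_abs, one_mul]
    exact hz _
  · intro hy
    refine ⟨(sg g).symm y, fun i => ?_, by simp⟩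
    rw [sg_symm_apply, abs_mul, unit_abs, one_mul]
    exact hy _

lemma sg_comp (g h : G d) : ∃ k : G d, ∀ y, sg g (sg h y) = sg k y := by
  refine ⟨(g.1.trans h.1, fun i => g.2 i * h.2 (g.1 i)), fun y => ?_⟩
  ext i
  simp only [sg_apply]
  push_cast
  simp [mul_assoc]

lemma sg_inv (g : G d) : ∃ k : G d, ∀ y, sg g (sg k y) = y := by
  refine ⟨(g.1.symm, fun i => g.2 (g.1.symm i)), fun y => ?_⟩
  ext i
  simp [sg_apply, ← mul_assoc, unit_sq]

lemma sg_one (y : Pt d) : sg (1, 1) y = y := by ext i; simp [sg_apply]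

lemma sg_neg (y : Pt d) : sg (1, fun _ => -1) y = -y := by ext i; simp [sg_apply]

/-- affine version centred at `x` -/
noncomputable def ax (x : Pt d) (g : G d) : Pt d ≃ᵢ Pt d :=
  ((IsometryEquiv.addRight (-x)).trans (sg g).toIsometryEquiv).trans (IsometryEquiv.addRight x)

lemma ax_apply (x : Pt d) (g : G d) (y : Pt d) : ax x g y = sg g (y + -x) + x := rfl

lemma ax_comp (x : Pt d) (g h : G d) : ∃ k : G d, ∀ y, ax x g (ax x h y) = ax x k y := by
  obtain ⟨k, hk⟩ := sg_comp g h
  exact ⟨k, fun y => by simp [ax_apply, hk]⟩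

lemma ax_inv (x : Pt d) (g : G d) : ∃ k : G d, ∀ y, ax x g (ax x k y) = y := by
  obtain ⟨k, hk⟩ := sg_inv g
  exact ⟨k, fun y => by simp [ax_apply, hk]⟩

lemma ax_dist (x : Pt d) (g : G d) (y : Pt d) : dist (ax x g y) x = dist y x := by
  rw [ax_apply, dist_eq_norm, dist_eq_norm, add_sub_cancel_right, LinearIsometryEquiv.norm_map,
    sub_eq_add_neg]

lemma ax_mp (x : Pt d) (g : G d) : MeasurePreserving (ax x g) volume volume := by
  have h1 := measurePreserving_add_right (volume : Measure (Pt d)) (-x)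
  have h2 := (sg g).measurePreserving
  have h3 := measurePreserving_add_right (volume : Measure (Pt d)) x
  exact h3.comp (h2.comp h1)

/-- invariance of a set under all signed permutations centred at `x` -/
def Inv (x : Pt d) (S : Set (Pt d)) : Prop := ∀ g : G d, ∀ y ∈ S, ax x g y ∈ S

lemma Inv.image {x : Pt d} {S : Set (Pt d)} (h : Inv x S) (g : G d) : ax x g '' S = S := by
  apply Set.Subset.antisymm
  · rintro _ ⟨y, hy, rfl⟩; exact h g y hy
  · intro y hy
    obtain ⟨k, hk⟩ := ax_inv x g
    exact ⟨_, h k y hy, hk y⟩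

lemma Inv.preimage {x : Pt d} {S : Set (Pt d)} (h : Inv x S) (g : G d) :
    ax x g ⁻¹' S = S := by
  conv_lhs => rw [← h.image g]
  exact Set.preimage_image_eq _ (ax x g).injective

lemma inv_of_image {x : Pt d} {S : Set (Pt d)} (h : ∀ g, ax x g '' S = S) : Inv x S :=
  fun g y hy => by rw [← h g]; exact ⟨y, hy, rfl⟩

lemma inv_ball (x : Pt d) (r : ℝ) : Inv x (ball x r) := fun g y hy => by
  rw [mem_ball, ax_dist]; exact hy

variable {Φ : Set (Pt d) → Set (Pt d) → Set (Pt d)}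

lemma good_image {A : Set (Pt d)} (hA : GoodSet A) (f : Pt d ≃ᵢ Pt d) : GoodSet (f '' A) :=
  ⟨f.toHomeomorph.isOpenMap _ hA.1, f.isometry.lipschitz.isBounded_image hA.2⟩

lemma sum_ax (hax : SumAxioms d Φ) (x : Pt d) (g : G d) {A B : Set (Pt d)} (hA : GoodSet A)
    (hB : GoodSet B) : Φ (ax x g '' A) (ax x g '' B) = ax x g '' (Φ A B) := by
  have key : ∀ S : Set (Pt d), ax x g '' S = (· + x) '' (sg g '' ((· + -x) '' S)) := by
    intro S; rw [Set.image_image, Set.image_image]; rfl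
  have hA1 := good_image hA (IsometryEquiv.addRight (-x))
  have hB1 := good_image hB (IsometryEquiv.addRight (-x))
  have hA2 := good_image hA1 (sg g).toIsometryEquiv
  have hB2 := good_image hB1 (sg g).toIsometryEquiv
  rw [key, key, key]
  refine (hax.translate _ _ x hA2 hB2).trans ?_
  congr 1
  refine (hax.rotate _ _ (sg g) (sg_cubic g) hA1 hB1).trans ?_
  congr 1
  exact hax.translate _ _ (-x) hA hB

lemma good_ball (x : Pt d) (r : ℝ) : GoodSet (ball x r) := ⟨isOpen_ball, isBounded_ball⟩

lemma subset_sum_right (hax : SumAxioms d Φ) {A B : Set (Pt d)} (hA : GoodSet A)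
    (hB : GoodSet B) : B ⊆ Φ A B := by
  rw [hax.comm A B hA hB]; exact hax.subset_sum B A hB hA

lemma mono2 (hax : SumAxioms d Φ) {A A' B B' : Set (Pt d)} (hA : GoodSet A) (hA' : GoodSet A')
    (hB : GoodSet B) (hB' : GoodSet B') (h : A ⊆ A') (h' : B ⊆ B') : Φ A B ⊆ Φ A' B' := by
  refine (hax.mono A A' B hA hA' hB h).trans ?_
  rw [hax.comm A' B hA' hB, hax.comm A' B' hA' hB']
  exact hax.mono B B' A' hB hB' hA' h'

/-- locality -/
lemma sum_ball_subset [Nontrivial (Pt d)] (hax : SumAxioms d Φ) :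
    ∃ K : ℝ, 0 < K ∧ ∀ (x : Pt d) (R ε : ℝ), 0 < R → 0 < ε →
      Φ (ball x R) (ball x ε) ⊆ ball x (R + K * ε) := by
  obtain ⟨q, hq, hq2⟩ : ∃ q : ℝ, 0 < q ∧ (q + 1) ^ d < 2 := by
    have hc : Filter.Tendsto (fun q : ℝ => (q + 1) ^ d) (nhdsWithin 0 (Set.Ioi 0)) (nhds 1) := by
      have : Continuous (fun q : ℝ => (q + 1) ^ d) := by fun_prop
      have := this.tendsto 0
      simp only [zero_add, one_pow] at this
      exact this.mono_left nhdsWithin_le_nhds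
    have h1 := hc.eventually (gt_mem_nhds (show (1 : ℝ) < 2 by norm_num))
    obtain ⟨q, h, h'⟩ := (h1.and self_mem_nhdsWithin).exists
    exact ⟨q, h', h⟩
  refine ⟨2 / q, by positivity, fun x R ε hR hε y hy => ?_⟩
  by_contra hcon
  rw [mem_ball, not_lt] at hcon
  set η := ε / q with hη
  have hη0 : 0 < η := by positivity
  have hεη : ε = q * η := by rw [hη]; field_simp
  have hcon' : R + 2 * η ≤ dist y x := by
    refine le_trans (le_of_eq ?_) hcon
    rw [hη]; ring
  have hg := good_ball (d := d)
  set Z := Φ (ball x (R + η)) (ball x (ε + η)) with hZ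
  have hsub : ∀ y ∈ Φ (ball x R) (ball x ε), ball y η ⊆ Z := by
    intro y hy z hz
    have h1 : z ∈ (· + (z - y)) '' Φ (ball x R) (ball x ε) := ⟨y, hy, by simp⟩
    rw [← hax.translate _ _ _ (hg _ _) (hg _ _)] at h1
    have hzy : ‖z - y‖ < η := by rwa [mem_ball, dist_eq_norm] at hz
    refine mono2 hax (good_image (hg _ _) (IsometryEquiv.addRight (z - y))) (hg _ _)
      (good_image (hg _ _) (IsometryEquiv.addRight (z - y))) (hg _ _) ?_ ?_ h1
    · rintro _ ⟨w, hw, rfl⟩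
      have : dist (w + (z - y)) x ≤ dist w x + ‖z - y‖ := by
        rw [dist_eq_norm, dist_eq_norm]
        calc ‖w + (z - y) - x‖ = ‖(w - x) + (z - y)‖ := by congr 1; abel
          _ ≤ _ := norm_add_le _ _
      rw [mem_ball] at hw ⊢
      change dist (w + (z - y)) x < _
      linarith
    · rintro _ ⟨w, hw, rfl⟩
      have : dist (w + (z - y)) x ≤ dist w x + ‖z - y‖ := by
        rw [dist_eq_norm, dist_eq_norm]
        calc ‖w + (z - y) - x‖ = ‖(w - x) + (z - y)‖ := by congr 1; abel
          _ ≤ _ := norm_add_le _ _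
      rw [mem_ball] at hw ⊢
      change dist (w + (z - y)) x < _
      linarith
  set gn : G d := (1, fun _ => -1) with hgn
  have hy' : ax x gn y ∈ Φ (ball x R) (ball x ε) := by
    have h1 : ax x gn y ∈ ax x gn '' Φ (ball x R) (ball x ε) := ⟨y, hy, rfl⟩
    rwa [← sum_ax hax x gn (hg _ _) (hg _ _), (inv_ball x R).image, (inv_ball x ε).image] at h1
  have hyy : dist y (ax x gn y) = 2 * dist y x := by
    rw [ax_apply, sg_neg, dist_eq_norm, dist_eq_norm]
    have : y - (-(y + -x) + x) = (2 : ℝ) • (y - x) := by rw [two_smul]; abel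
    rw [this, norm_smul]; simp
  have hd1 : Disjoint (ball y η) (ball (ax x gn y) η) := by
    apply ball_disjoint_ball; rw [hyy]; linarith
  have hd2 : Disjoint (ball x (R + η)) (ball y η ∪ ball (ax x gn y) η) := by
    rw [Set.disjoint_union_right]
    constructor
    · apply ball_disjoint_ball; rw [dist_comm]; linarith
    · apply ball_disjoint_ball; rw [dist_comm, ax_dist]; linarith
  have hsubZ : ball x (R + η) ∪ (ball y η ∪ ball (ax x gn y) η) ⊆ Z :=
    Set.union_subset (hax.subset_sum _ _ (hg _ _) (hg _ _))
      (Set.union_subset (hsub _ hy) (hsub _ hy'))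
  have hm := measure_mono (μ := volume) hsubZ
  rw [measure_union hd2 (isOpen_ball.union isOpen_ball).measurableSet,
    measure_union hd1 isOpen_ball.measurableSet, hZ, hax.conserve _ _ (hg _ _) (hg _ _)] at hm
  have hfin : volume (ball x (R + η)) ≠ ⊤ := measure_ball_lt_top.ne
  have hm2 := (ENNReal.add_le_add_iff_left hfin).1 hm
  rw [Measure.addHaar_ball volume y hη0.le, Measure.addHaar_ball volume (ax x gn y) hη0.le,
    Measure.addHaar_ball volume x (show 0 ≤ ε + η by positivity), ← add_mul] at hm2
  have hb0 : volume (ball (0 : Pt d) 1) ≠ 0 := (measure_ball_pos _ _ one_pos).ne'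
  have hbt : volume (ball (0 : Pt d) 1) ≠ ⊤ := measure_ball_lt_top.ne
  rw [ENNReal.mul_le_mul_iff_left hb0 hbt, ← ENNReal.ofReal_add (by positivity) (by positivity),
    ENNReal.ofReal_le_ofReal_iff (by positivity)] at hm2
  have hfr : Module.finrank ℝ (Pt d) = d := by simp
  rw [hfr, hεη] at hm2
  have : q * η + η = (q + 1) * η := by ring
  rw [this, mul_pow] at hm2
  have : 0 < η ^ d := by positivity
  nlinarith

lemma sum_good [Nontrivial (Pt d)] (hax : SumAxioms d Φ) {A B : Set (Pt d)} (hA : GoodSet A)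
    (hB : GoodSet B) : GoodSet (Φ A B) := by
  refine ⟨hax.isOpen _ _ hA hB, ?_⟩
  obtain ⟨K, -, hK⟩ := sum_ball_subset hax
  obtain ⟨R, hR, h⟩ := (hA.2.union hB.2).subset_ball_lt 0 0
  refine isBounded_ball.subset ((mono2 hax hA (good_ball 0 R) hB (good_ball 0 R) ?_ ?_).trans
    (hK 0 R R hR hR))
  · exact Set.subset_union_left.trans h
  · exact Set.subset_union_right.trans h

lemma good_lt_top {A : Set (Pt d)} (hA : GoodSet A) : volume A < ⊤ := hA.2.measure_lt_top

lemma ae_eq_of_subset {A B : Set (Pt d)} (hA : MeasurableSet A) (h : A ⊆ B)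
    (hm : volume B ≤ volume A) (hf : volume B ≠ ⊤) : A =ᵐ[volume] B :=
  ae_eq_of_subset_of_measure_ge h hm hA.nullMeasurableSet hf

lemma sum_disj [Nontrivial (Pt d)] (hax : SumAxioms d Φ) {A B : Set (Pt d)} (hA : GoodSet A) (hB : GoodSet B) (h : Disjoint A B) :
    Φ A B =ᵐ[volume] (A ∪ B : Set (Pt d)) := by
  symm
  refine ae_eq_of_subset (hA.1.union hB.1).measurableSet
    (Set.union_subset (hax.subset_sum _ _ hA hB) (subset_sum_right hax hA hB)) ?_
    (good_lt_top (sum_good hax hA hB)).ne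
  rw [measure_union h hB.1.measurableSet, hax.conserve _ _ hA hB]

lemma eq_of_ae (hax : SumAxioms d Φ)
    (hbulky : ∀ A B, GoodSet A → GoodSet B → Bulky (Φ A B))
    {A B A' B' : Set (Pt d)} (hA : GoodSet A) (hB : GoodSet B) (hA' : GoodSet A')
    (hB' : GoodSet B') (h : Φ A B =ᵐ[volume] Φ A' B') : Φ A B = Φ A' B' := by
  apply Set.Subset.antisymm
  · refine (hbulky A' B' hA' hB').2 _ (hax.isOpen _ _ hA hB) ?_
    exact measure_symmDiff_eq_zero_iff.2 h
  · refine (hbulky A B hA hB).2 _ (hax.isOpen _ _ hA' hB') ?_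
    exact measure_symmDiff_eq_zero_iff.2 h.symm

lemma congr_left [Nontrivial (Pt d)] (hax : SumAxioms d Φ)
    (hbulky : ∀ A B, GoodSet A → GoodSet B → Bulky (Φ A B))
    {A A' B : Set (Pt d)} (hA : GoodSet A) (hA' : GoodSet A') (hB : GoodSet B)
    (h : A =ᵐ[volume] A') : Φ A B = Φ A' B := by
  have hI : GoodSet (A ∩ A') := ⟨hA.1.inter hA'.1, hA.2.subset Set.inter_subset_left⟩
  have key : ∀ A A' : Set (Pt d), GoodSet A → GoodSet A' → A =ᵐ[volume] A' →
      Φ (A ∩ A') B =ᵐ[volume] Φ A B := by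
    intro A A' hA hA' h
    have hI : GoodSet (A ∩ A') := ⟨hA.1.inter hA'.1, hA.2.subset Set.inter_subset_left⟩
    have hi : (A ∩ A' : Set (Pt d)) =ᵐ[volume] A := by
      have := (Filter.EventuallyEq.refl (ae volume) A).inter h.symm
      simpa using this
    refine ae_eq_of_subset (hax.isOpen _ _ hI hB).measurableSet
      (hax.mono _ _ _ hI hA hB Set.inter_subset_left) ?_ (good_lt_top (sum_good hax hA hB)).ne
    rw [hax.conserve _ _ hA hB, hax.conserve _ _ hI hB, measure_congr hi]
  refine eq_of_ae hax hbulky hA hB hA' hB ?_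
  have h2 := key A' A hA' hA h.symm
  rw [Set.inter_comm] at h2
  exact (key A A' hA hA' h).symm.trans h2

lemma congr_right [Nontrivial (Pt d)] (hax : SumAxioms d Φ)
    (hbulky : ∀ A B, GoodSet A → GoodSet B → Bulky (Φ A B))
    {A B B' : Set (Pt d)} (hA : GoodSet A) (hB : GoodSet B) (hB' : GoodSet B')
    (h : B =ᵐ[volume] B') : Φ A B = Φ A B' := by
  rw [hax.comm A B hA hB, hax.comm A B' hA hB']
  exact congr_left hax hbulky hB hB' hA h

lemma assoc' [Nontrivial (Pt d)] (hax : SumAxioms d Φ) {A B C : Set (Pt d)} (hA : GoodSet A) (hB : GoodSet B) (hC : GoodSet C) :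
    Φ (Φ A B) C = Φ A (Φ B C) :=
  hax.assoc A B C hA hB hC (sum_good hax hA hB).2 (sum_good hax hB hC).2

/-- adding a disjoint union -/
lemma sum_union [Nontrivial (Pt d)] (hax : SumAxioms d Φ)
    (hbulky : ∀ A B, GoodSet A → GoodSet B → Bulky (Φ A B))
    {A W b : Set (Pt d)} (hA : GoodSet A) (hW : GoodSet W) (hb : GoodSet b)
    (h : Disjoint W b) : Φ A (W ∪ b) = Φ (Φ A W) b := by
  have hWb : GoodSet (W ∪ b) := ⟨hW.1.union hb.1, hW.2.union hb.2⟩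
  rw [assoc' hax hA hW hb]
  exact congr_right hax hbulky hA hWb (sum_good hax hW hb) (sum_disj hax hW hb h).symm

end SumQD
end

section
open MeasureTheory Metric Bornology

namespace SumQD

variable {d : ℕ} {Φ : Set (Pt d) → Set (Pt d) → Set (Pt d)}

lemma int_good {v : Pt d → ℝ} (hv : Continuous v) {A : Set (Pt d)} (hA : IsBounded A) :
    IntegrableOn v A :=
  (hv.continuousOn.integrableOn_compact hA.isCompact_closure).mono_set subset_closure

/-- the defect -/
noncomputable def Df (Φ : Set (Pt d) → Set (Pt d) → Set (Pt d)) (v : Pt d → ℝ)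
    (A B : Set (Pt d)) : ℝ :=
  (∫ y in Φ A B, v y) - (∫ y in A, v y) - ∫ y in B, v y

def TT (Φ : Set (Pt d) → Set (Pt d) → Set (Pt d)) (Q : Set (Pt d)) (v : Pt d → ℝ) (θ : ℝ) :
    Prop :=
  ∀ A B, GoodSet A → GoodSet B → Φ A B ⊆ Q → Df Φ v A B ≤ θ * volume.real (A ∩ B)

lemma excess [Nontrivial (Pt d)] (hax : SumAxioms d Φ) {A B : Set (Pt d)} (hA : GoodSet A)
    (hB : GoodSet B) : volume.real (Φ A B \ (A ∪ B)) = volume.real (A ∩ B) := by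
  have h1 : A ∪ B ⊆ Φ A B :=
    Set.union_subset (hax.subset_sum _ _ hA hB) (subset_sum_right hax hA hB)
  have hU : GoodSet (A ∪ B) := ⟨hA.1.union hB.1, hA.2.union hB.2⟩
  have h2 : volume.real (Φ A B \ (A ∪ B)) = volume.real (Φ A B) - volume.real (A ∪ B) :=
    measureReal_sdiff h1 hU.1.measurableSet (good_lt_top (sum_good hax hA hB)).ne
  have h3 : volume.real (A ∪ B) + volume.real (A ∩ B) = volume.real A + volume.real B :=
    measureReal_union_add_inter hB.1.measurableSet (good_lt_top hA).ne (good_lt_top hB).ne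
  have h4 : volume.real (Φ A B) = volume.real A + volume.real B := by
    simp only [Measure.real]
    rw [hax.conserve _ _ hA hB, ENNReal.toReal_add (good_lt_top hA).ne (good_lt_top hB).ne]
  linarith

lemma Df_gen [Nontrivial (Pt d)] (hax : SumAxioms d Φ) {Q : Set (Pt d)} {v : Pt d → ℝ}
    (hv : Continuous v) {M : ℝ} (hM : ∀ y ∈ Q, |v y| ≤ M) : TT Φ Q v (2 * M) := by
  intro A B hA hB hQ
  have hS := sum_good hax hA hB
  have h1 : A ∪ B ⊆ Φ A B :=
    Set.union_subset (hax.subset_sum _ _ hA hB) (subset_sum_right hax hA hB)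
  have hU : GoodSet (A ∪ B) := ⟨hA.1.union hB.1, hA.2.union hB.2⟩
  have e1 : ∫ y in Φ A B \ (A ∪ B), v y = (∫ y in Φ A B, v y) - ∫ y in A ∪ B, v y :=
    setIntegral_sdiff hU.1.measurableSet (int_good hv hS.2) h1
  have e2 : ∫ y in A ∪ B, v y = (∫ y in A, v y) + ∫ y in B \ A, v y := by
    rw [← Set.union_sdiff_self]
    exact setIntegral_union Set.disjoint_sdiff_right (hB.1.measurableSet.diff hA.1.measurableSet)
      (int_good hv hA.2) (int_good hv (hB.2.subset Set.sdiff_subset))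
  have e3 := integral_inter_add_sdiff hA.1.measurableSet (int_good hv hB.2)
  have b1 := norm_setIntegral_le_of_norm_le_const (μ := volume) (f := v)
    (s := Φ A B \ (A ∪ B)) (C := M)
    ((measure_mono Set.sdiff_subset).trans_lt (good_lt_top hS)) (fun y hy => hM y (hQ hy.1))
  have b2 := norm_setIntegral_le_of_norm_le_const (μ := volume) (f := v)
    (s := B ∩ A) (C := M)
    ((measure_mono Set.inter_subset_left).trans_lt (good_lt_top hB))
    (fun y hy => hM y (hQ (h1 (Or.inr hy.1))))
  rw [excess hax hA hB] at b1
  rw [Set.inter_comm B A] at b2 e3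
  rw [Real.norm_eq_abs] at b1 b2
  have := abs_le.1 b1
  have := abs_le.1 b2
  unfold Df
  linarith

lemma Df_union [Nontrivial (Pt d)] (hax : SumAxioms d Φ)
    (hbulky : ∀ A B, GoodSet A → GoodSet B → Bulky (Φ A B)) {v : Pt d → ℝ}
    (hv : Continuous v) {A W b : Set (Pt d)} (hA : GoodSet A) (hW : GoodSet W) (hb : GoodSet b)
    (h : Disjoint W b) : Df Φ v A (W ∪ b) = Df Φ v A W + Df Φ v (Φ A W) b := by
  unfold Df
  rw [sum_union hax hbulky hA hW hb h,
    setIntegral_union h hb.1.measurableSet (int_good hv hW.2) (int_good hv hb.2)]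
  ring

lemma Df_finset [Nontrivial (Pt d)] (hax : SumAxioms d Φ)
    (hbulky : ∀ A B, GoodSet A → GoodSet B → Bulky (Φ A B)) {v : Pt d → ℝ}
    (hv : Continuous v) {Q : Set (Pt d)} {θ ε₀ : ℝ}
    (Hb : ∀ A, GoodSet A → ∀ x ε, 0 < ε → ε < ε₀ → ball x ε ⊆ A → Φ A (ball x ε) ⊆ Q →
      Df Φ v A (ball x ε) ≤ θ * volume.real (ball x ε))
    {A O : Set (Pt d)} (hA : GoodSet A) (hO : GoodSet O) (r : Pt d → ℝ) (F : Finset (Pt d))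
    (hF : ∀ x ∈ F, 0 < r x ∧ r x < ε₀ ∧ ball x (r x) ⊆ A ∧ Disjoint O (ball x (r x)))
    (hd : (F : Set (Pt d)).PairwiseDisjoint fun x => ball x (r x))
    (hQ : Φ A (O ∪ ⋃ x ∈ F, ball x (r x)) ⊆ Q) :
    Df Φ v A (O ∪ ⋃ x ∈ F, ball x (r x)) ≤
      Df Φ v A O + θ * ∑ x ∈ F, volume.real (ball x (r x)) := by
  classical
  induction F using Finset.induction_on with
  | empty => simp
  | insert x F hx ih =>
    have hW : GoodSet (O ∪ ⋃ x ∈ F, ball x (r x)) := by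
      refine ⟨hO.1.union (isOpen_biUnion fun _ _ => isOpen_ball), hO.2.union ?_⟩
      exact (isBounded_biUnion_finset F).2 fun _ _ => isBounded_ball
    have hdis : Disjoint (O ∪ ⋃ x ∈ F, ball x (r x)) (ball x (r x)) := by
      rw [Set.disjoint_union_left]
      refine ⟨(hF x (Finset.mem_insert_self _ _)).2.2.2, ?_⟩
      simp only [Set.disjoint_iUnion_left]
      intro y hy
      refine hd (by simp [hy]) (by simp) ?_
      rintro rfl; exact hx hy
    have e : (O ∪ ⋃ y ∈ insert x F, ball y (r y)) =
        (O ∪ ⋃ x ∈ F, ball x (r x)) ∪ ball x (r x) := by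
      rw [Finset.set_biUnion_insert, Set.union_comm (ball x (r x)), Set.union_assoc]
    have hxF := hF x (Finset.mem_insert_self _ _)
    rw [e] at hQ ⊢
    rw [Df_union hax hbulky hv hA hW (good_ball _ _) hdis, Finset.sum_insert hx, mul_add]
    rw [sum_union hax hbulky hA hW (good_ball _ _) hdis] at hQ
    have hAW := sum_good hax hA hW
    have h1 := Hb (Φ A (O ∪ ⋃ x ∈ F, ball x (r x))) hAW x (r x) hxF.1 hxF.2.1
      (hxF.2.2.1.trans (hax.subset_sum _ _ hA hW)) hQ
    have h2 := ih (fun y hy => hF y (Finset.mem_insert_of_mem hy))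
      (hd.subset (by simp)) ((hax.subset_sum _ _ hAW (good_ball _ _)).trans hQ)
    linarith

lemma exists_balls (S : Set (Pt d)) (hS : GoodSet S) {ε₀ κ : ℝ} (hε : 0 < ε₀) (hκ : 0 < κ) :
    ∃ (F : Finset (Pt d)) (r : Pt d → ℝ), (∀ x ∈ F, 0 < r x ∧ r x < ε₀ ∧ closedBall x (r x) ⊆ S) ∧
      (F : Set (Pt d)).PairwiseDisjoint (fun x => closedBall x (r x)) ∧
      volume.real (S \ ⋃ x ∈ F, closedBall x (r x)) ≤ κ := by
  have hR : ∀ x ∈ S, ∃ R, 0 < R ∧ R ≤ ε₀ ∧ ball x R ⊆ S := by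
    intro x hx
    obtain ⟨R, hR, h⟩ := Metric.isOpen_iff.1 hS.1 x hx
    exact ⟨min R ε₀, lt_min hR hε, min_le_right _ _, (ball_subset_ball (min_le_left _ _)).trans h⟩
  choose! R hR0 hR1 hR2 using hR
  obtain ⟨t, r, ht, hts, hr, hnull, hdis⟩ := Besicovitch.exists_disjoint_closedBall_covering_ae
    (volume : Measure (Pt d)) (fun _ => Set.univ) S
    (fun x _ δ hδ => ⟨δ / 2, trivial, by simp; exact hδ⟩) R hR0
  have : Countable t := ht.to_subtype
  have hlim := tendsto_measure_iInter_atTop (μ := (volume : Measure (Pt d)))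
    (s := fun F : Finset t => S \ ⋃ x ∈ F, closedBall (x : Pt d) (r x))
    (fun F => (hS.1.measurableSet.diff (F.measurableSet_biUnion
      fun _ _ => isClosed_closedBall.measurableSet)).nullMeasurableSet)
    (fun F F' h => by
      apply Set.sdiff_subset_sdiff_right
      exact Set.biUnion_subset_biUnion_left h)
    ⟨∅, ((measure_mono Set.sdiff_subset).trans_lt (good_lt_top hS)).ne⟩
  have e0 : volume (⋂ F : Finset t, (S \ ⋃ x ∈ F, closedBall (x : Pt d) (r x))) = 0 := by
    refine measure_mono_null ?_ hnull
    intro y hy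
    rw [Set.mem_iInter] at hy
    refine ⟨(hy ∅).1, ?_⟩
    simp only [Set.mem_iUnion, not_exists]
    intro x hx hxy
    apply (hy {⟨x, hx⟩}).2
    simpa using hxy
  rw [e0] at hlim
  obtain ⟨F, hF⟩ := (hlim.eventually (gt_mem_nhds (ENNReal.ofReal_pos.2 hκ))).exists
  classical
  refine ⟨F.map (Function.Embedding.subtype _), r, ?_, ?_, ?_⟩
  · intro x hx
    simp only [Finset.mem_map, Function.Embedding.subtype_apply] at hx
    obtain ⟨⟨y, hy⟩, hyF, rfl⟩ := hx
    have := (hr y hy).2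
    refine ⟨this.1, this.2.trans_le (hR1 y (hts hy)), ?_⟩
    exact (closedBall_subset_ball this.2).trans (hR2 y (hts hy))
  · refine hdis.subset ?_
    intro x hx
    simp at hx
    exact hx.1
  · have e : (⋃ x ∈ F.map (Function.Embedding.subtype _), closedBall x (r x)) =
        ⋃ x ∈ F, closedBall (x : Pt d) (r x) := by
      ext z; simp
    rw [e]
    exact (ENNReal.toReal_mono ENNReal.ofReal_ne_top hF.le).trans_eq
      (ENNReal.toReal_ofReal hκ.le)

lemma ball_ae_closedBall [Nontrivial (Pt d)] (x : Pt d) (r : ℝ) :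
    ball x r =ᵐ[volume] closedBall x r := by
  refine ae_eq_of_subset isOpen_ball.measurableSet ball_subset_closedBall ?_
    measure_closedBall_lt_top.ne
  rw [Measure.addHaar_closedBall_eq_addHaar_ball]

lemma TT_of_balls [Nontrivial (Pt d)] (hax : SumAxioms d Φ)
    (hbulky : ∀ A B, GoodSet A → GoodSet B → Bulky (Φ A B)) {v : Pt d → ℝ}
    (hv : Continuous v) {Q : Set (Pt d)} {θ ε₀ M : ℝ} (hM : ∀ y ∈ Q, |v y| ≤ M)
    (hθ : 0 ≤ θ) (hε : 0 < ε₀)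
    (Hb : ∀ A, GoodSet A → ∀ x ε, 0 < ε → ε < ε₀ → ball x ε ⊆ A → Φ A (ball x ε) ⊆ Q →
      Df Φ v A (ball x ε) ≤ θ * volume.real (ball x ε)) : TT Φ Q v θ := by
  intro A B hA hB hQ
  apply le_of_forall_pos_le_add
  intro κ' hκ'
  set κ := κ' / (2 * |M| + 1) with hκ
  have hκ0 : 0 < κ := by positivity
  have hκ1 : 2 * |M| * κ ≤ κ' := by
    rw [hκ, mul_div_assoc', div_le_iff₀ (by positivity)]
    nlinarith [abs_nonneg M]
  have hI : GoodSet (A ∩ B) := ⟨hA.1.inter hB.1, hA.2.subset Set.inter_subset_left⟩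
  obtain ⟨F, r, hF, hdis, hm⟩ := exists_balls (A ∩ B) hI hε hκ0
  set O := B \ ⋃ x ∈ F, closedBall x (r x) with hO
  have hOg : GoodSet O := by
    refine ⟨hB.1.sdiff (F.finite_toSet.isClosed_biUnion fun _ _ => isClosed_closedBall),
      hB.2.subset Set.sdiff_subset⟩
  have hae : (O ∪ ⋃ x ∈ F, ball x (r x) : Set (Pt d)) =ᵐ[volume] B := by
    have h1 : (⋃ x ∈ F, ball x (r x) : Set (Pt d)) =ᵐ[volume] ⋃ x ∈ F, closedBall x (r x) := by
      have := Filter.EventuallyEq.countable_bUnion (l := ae (volume : Measure (Pt d)))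
        F.countable_toSet (s := fun x _ => ball x (r x)) (t := fun x _ => closedBall x (r x))
        (fun x _ => ball_ae_closedBall x (r x))
      simpa using this
    have h2 := (Filter.EventuallyEq.refl (ae volume) O).union h1
    have h3 : (O ∪ ⋃ x ∈ F, closedBall x (r x)) = B := by
      rw [hO, Set.sdiff_union_self, Set.union_eq_left]
      exact Set.iUnion₂_subset fun x hx => (hF x hx).2.2.trans Set.inter_subset_right
    rwa [h3] at h2
  have hW : GoodSet (O ∪ ⋃ x ∈ F, ball x (r x)) := by
    refine ⟨hOg.1.union (isOpen_biUnion fun _ _ => isOpen_ball), hOg.2.union ?_⟩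
    exact (isBounded_biUnion_finset F).2 fun _ _ => isBounded_ball
  have hΦ := congr_right hax hbulky hA hW hB hae
  have hDe : Df Φ v A B = Df Φ v A (O ∪ ⋃ x ∈ F, ball x (r x)) := by
    unfold Df
    rw [hΦ, setIntegral_congr_set hae]
  have hdis' : (F : Set (Pt d)).PairwiseDisjoint fun x => ball x (r x) :=
    fun x hx y hy hxy => (hdis hx hy hxy).mono ball_subset_closedBall ball_subset_closedBall
  have h1 := Df_finset hax hbulky hv Hb hA hOg r F (fun x hx => ⟨(hF x hx).1, (hF x hx).2.1,
    ball_subset_closedBall.trans ((hF x hx).2.2.trans Set.inter_subset_left), by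
      rw [hO]
      refine Set.disjoint_sdiff_left.mono_right (ball_subset_closedBall.trans ?_)
      exact Set.subset_biUnion_of_mem (u := fun x => closedBall x (r x)) hx⟩) hdis' (by rwa [hΦ])
  have h2 := Df_gen hax hv hM A O hA hOg
    ((mono2 hax hA hA hOg hB subset_rfl Set.sdiff_subset).trans hQ)
  have e3 : A ∩ O = (A ∩ B) \ ⋃ x ∈ F, closedBall x (r x) := by
    rw [hO, Set.inter_sdiff_assoc]
  rw [← e3] at hm
  have h4 : ∑ x ∈ F, volume.real (ball x (r x)) ≤ volume.real (A ∩ B) := by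
    rw [← measureReal_biUnion_finset hdis' (fun _ _ => isOpen_ball.measurableSet)]
    refine measureReal_mono ?_ (good_lt_top hI).ne
    exact Set.iUnion₂_subset fun x hx => ball_subset_closedBall.trans (hF x hx).2.2
  rw [hDe]
  have h5 : 2 * M * volume.real (A ∩ O) ≤ 2 * |M| * κ := by
    have := le_abs_self M
    have := abs_nonneg M
    have h0 : 0 ≤ volume.real (A ∩ O) := measureReal_nonneg
    nlinarith
  have h6 := mul_le_mul_of_nonneg_left h4 hθ
  linarith

end SumQD
end

section
open MeasureTheory Metric Bornology

namespace SumQD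

variable {d : ℕ} {Φ : Set (Pt d) → Set (Pt d) → Set (Pt d)}

lemma exists_shrink [Nontrivial (Pt d)] {C : Set (Pt d)} (hC : GoodSet C) {κ : ℝ} (hκ : 0 < κ) :
    ∃ C' : Set (Pt d), IsOpen C' ∧ closure C' ⊆ C ∧ (∀ x, Inv x C → Inv x C') ∧
      volume (closure C' \ C') = 0 ∧ volume.real (C \ C') ≤ κ := by
  have hne : (Cᶜ).Nonempty := by
    rw [Set.nonempty_compl]
    rintro rfl
    have := hC.2
    exact NormedSpace.unbounded_univ ℝ (Pt d) this
  have hcl : IsClosed Cᶜ := hC.1.isClosed_compl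
  have hpos : ∀ y, 0 < infDist y Cᶜ ↔ y ∈ C := by
    intro y
    rw [← hcl.notMem_iff_infDist_pos hne]; simp
  have hcont : Continuous fun y : Pt d => infDist y Cᶜ := continuous_infDist_pt _
  have hlim := tendsto_measure_iInter_atTop (μ := (volume : Measure (Pt d)))
    (s := fun n : ℕ => C \ {y | 1 / ((n : ℝ) + 1) < infDist y Cᶜ})
    (fun n => (hC.1.measurableSet.diff
      (isOpen_lt continuous_const hcont).measurableSet).nullMeasurableSet)
    (fun n m h => by
      apply Set.sdiff_subset_sdiff_right
      intro y hy
      rw [Set.mem_ofPred_eq] at hy ⊢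
      exact lt_of_le_of_lt (Nat.one_div_le_one_div h) hy)
    ⟨0, ((measure_mono Set.sdiff_subset).trans_lt (good_lt_top hC)).ne⟩
  have e0 : (⋂ n : ℕ, C \ {y | 1 / ((n : ℝ) + 1) < infDist y Cᶜ}) = ∅ := by
    rw [Set.eq_empty_iff_forall_notMem]
    intro y hy
    rw [Set.mem_iInter] at hy
    obtain ⟨n, hn⟩ := exists_nat_one_div_lt ((hpos y).2 (hy 0).1)
    exact (hy n).2 hn
  rw [e0, measure_empty] at hlim
  obtain ⟨n, hn⟩ := (hlim.eventually (gt_mem_nhds (ENNReal.ofReal_pos.2 hκ))).exists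
  have hcount := Measure.countable_meas_level_set_pos (μ := (volume : Measure (Pt d)))
    hcont.measurable
  obtain ⟨t, ht, ht0, htn⟩ := (hcount.dense_compl ℝ).exists_between
    (show (0 : ℝ) < 1 / ((n : ℝ) + 1) by positivity)
  have hlev : volume {a : Pt d | infDist a Cᶜ = t} = 0 := by
    by_contra h
    exact ht (pos_iff_ne_zero.2 h)
  have hclos : closure {y | t < infDist y Cᶜ} ⊆ {y | t ≤ infDist y Cᶜ} :=
    closure_minimal (fun y hy => by rw [Set.mem_ofPred_eq] at hy ⊢; exact hy.le) (isClosed_le continuous_const hcont)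
  refine ⟨{y | t < infDist y Cᶜ}, isOpen_lt continuous_const hcont, ?_, ?_, ?_, ?_⟩
  · intro y hy
    exact (hpos y).1 (ht0.trans_le (hclos hy))
  · intro x hx g y hy
    have hxc : ax x g '' Cᶜ = Cᶜ := by
      rw [Set.image_compl_eq (ax x g).bijective, hx.image g]
    have := infDist_image (x := y) (t := Cᶜ) (ax x g).isometry
    rw [hxc] at this
    change t < _
    rw [this]; exact hy
  · refine measure_mono_null ?_ hlev
    intro y hy
    exact le_antisymm (not_lt.1 hy.2) (hclos hy.1)
  · have h1 : volume (C \ {y | t < infDist y Cᶜ}) ≤ ENNReal.ofReal κ := by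
      refine le_trans (measure_mono ?_) hn.le
      apply Set.sdiff_subset_sdiff_right
      intro y hy
      exact htn.trans hy
    exact (ENNReal.toReal_mono ENNReal.ofReal_ne_top h1).trans_eq (ENNReal.toReal_ofReal hκ.le)

/-- replacing a ball by a symmetric set -/
lemma exists_E [Nontrivial (Pt d)] (hax : SumAxioms d Φ)
    (hbulky : ∀ A B, GoodSet A → GoodSet B → Bulky (Φ A B)) {A b C' : Set (Pt d)}
    (hA : GoodSet A) (hb : GoodSet b) (hC : GoodSet C') (hCA : closure C' ⊆ A)
    (hnull : volume (closure C' \ C') = 0) :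
    GoodSet (Φ C' b \ closure C') ∧ Φ A b = Φ A (Φ C' b \ closure C') ∧
      volume (Φ C' b \ closure C') = volume b := by
  set E := Φ C' b \ closure C' with hE
  have hCb := sum_good hax hC hb
  have hEg : GoodSet E := ⟨hCb.1.sdiff isClosed_closure, hCb.2.subset Set.sdiff_subset⟩
  have hclae : closure C' =ᵐ[volume] C' := by
    have := (ae_le_set.2 hnull)
    exact Filter.EventuallyLE.antisymm this (HasSubset.Subset.eventuallyLE subset_closure)
  have hdiff : ∀ S : Set (Pt d), C' ⊆ S → (C' ∪ S \ closure C' : Set (Pt d)) =ᵐ[volume] S := by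
    intro S hS
    have h1 := (Filter.EventuallyEq.refl (ae volume) C').union
      ((Filter.EventuallyEq.refl (ae volume) S).diff hclae)
    have h2 : C' ∪ S \ C' = S := by rw [Set.union_sdiff_self, Set.union_eq_right.2 hS]
    rwa [h2] at h1
  have hdis : ∀ S : Set (Pt d), Disjoint C' (S \ closure C') :=
    fun S => Set.disjoint_sdiff_right.mono_left subset_closure
  have hD : GoodSet (A \ closure C') :=
    ⟨hA.1.sdiff isClosed_closure, hA.2.subset Set.sdiff_subset⟩
  have hA' : Φ (A \ closure C') C' =ᵐ[volume] A := by
    refine (sum_disj hax hD hC (hdis A).symm).trans ?_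
    rw [Set.union_comm]
    exact hdiff A (subset_closure.trans hCA)
  have hE' : Φ C' E =ᵐ[volume] Φ C' b :=
    (sum_disj hax hC hEg (hdis _)).trans (hdiff _ (hax.subset_sum _ _ hC hb))
  have hDC := sum_good hax hD hC
  refine ⟨hEg, ?_, ?_⟩
  · rw [← congr_left hax hbulky hDC hA hb hA', ← congr_left hax hbulky hDC hA hEg hA',
      assoc' hax hD hC hb, assoc' hax hD hC hEg]
    exact congr_right hax hbulky hD hCb (sum_good hax hC hEg) hE'.symm
  · have h1 := measure_congr hE'
    rw [hax.conserve _ _ hC hb, hax.conserve _ _ hC hEg] at h1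
    exact (ENNReal.add_right_inj (good_lt_top hC).ne).1 h1

lemma E_inv (hax : SumAxioms d Φ) {x : Pt d} {b C' : Set (Pt d)}
    (hb : GoodSet b) (hC : GoodSet C') (hxb : Inv x b) (hxC : Inv x C') :
    Inv x (Φ C' b \ closure C') := by
  apply inv_of_image
  intro g
  rw [Set.image_sdiff (ax x g).injective, ← sum_ax hax x g hC hb, hxC.image, hxb.image]
  have : ax x g '' closure C' = closure (ax x g '' C') :=
    (ax x g).toHomeomorph.image_closure C'
  rw [this, hxC.image]

lemma integral_inv {x : Pt d} {E : Set (Pt d)} (hE : Inv x E) (v : Pt d → ℝ) (g : G d) :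
    ∫ y in E, v (ax x g y) = ∫ y in E, v y := by
  have := (ax_mp x g).setIntegral_preimage_emb (ax x g).toHomeomorph.measurableEmbedding v E
  rwa [hE.preimage g] at this

lemma integral_E_le {x : Pt d} {E : Set (Pt d)} (hEg : GoodSet E) (hE : Inv x E) {v : Pt d → ℝ}
    (hv : Continuous v) {δ r : ℝ} (hδ : 0 < δ) (hr : 0 < r) (hsub : E ⊆ ball x (2 * r))
    (hSM : ∀ z : Pt d, ‖z‖ ≤ 2 * r → ∑ g : G d, v (x + sg g z) ≤
      Fintype.card (G d) * (v x - δ * ‖z‖ ^ 2)) :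
    ∫ y in E, v y ≤ v x * volume.real E - δ * r ^ 2 * volume.real (E \ ball x r) := by
  have hN : (0 : ℝ) < Fintype.card (G d) := by exact_mod_cast Fintype.card_pos
  have hcont : ∀ g : G d, Continuous fun y => v (ax x g y) :=
    fun g => hv.comp (ax x g).isometry.continuous
  have e1 : (Fintype.card (G d) : ℝ) * ∫ y in E, v y = ∫ y in E, ∑ g : G d, v (ax x g y) := by
    rw [integral_finsetSum _ (fun g _ => int_good (hcont g) hEg.2)]
    simp [integral_inv hE v]
  have hpt : ∀ y ∈ E, ∑ g : G d, v (ax x g y) ≤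
      Fintype.card (G d) * (v x - δ * ‖y - x‖ ^ 2) := by
    intro y hy
    have := hSM (y - x) (by have := hsub hy; rw [mem_ball, dist_eq_norm] at this; exact this.le)
    refine le_trans (le_of_eq ?_) this
    refine Finset.sum_congr rfl fun g _ => ?_
    rw [ax_apply, add_comm x, ← sub_eq_add_neg]
  have hci : Continuous fun y => ∑ g : G d, v (ax x g y) := by fun_prop
  have hb1 : IsBounded (E ∩ ball x r) := hEg.2.subset Set.inter_subset_left
  have hb2 : IsBounded (E \ ball x r) := hEg.2.subset Set.sdiff_subset
  have e2 := integral_inter_add_sdiff (μ := volume) (f := fun y => ∑ g : G d, v (ax x g y))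
    (isOpen_ball (x := x) (ε := r)).measurableSet (int_good hci hEg.2)
  have i1 : ∫ y in E ∩ ball x r, ∑ g : G d, v (ax x g y) ≤
      (Fintype.card (G d) * v x) * volume.real (E ∩ ball x r) := by
    have : ∫ y in E ∩ ball x r, ∑ g : G d, v (ax x g y) ≤
        ∫ y in E ∩ ball x r, (Fintype.card (G d) * v x : ℝ) := by
      refine setIntegral_mono_on (int_good hci hb1)
        (int_good continuous_const hb1) (hEg.1.inter isOpen_ball).measurableSet ?_
      intro y hy
      refine (hpt y hy.1).trans ?_
      have : 0 ≤ δ * ‖y - x‖ ^ 2 := by positivity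
      nlinarith
    refine this.trans_eq ?_
    rw [setIntegral_const, smul_eq_mul, mul_comm]
  have i2 : ∫ y in E \ ball x r, ∑ g : G d, v (ax x g y) ≤
      (Fintype.card (G d) * (v x - δ * r ^ 2)) * volume.real (E \ ball x r) := by
    have : ∫ y in E \ ball x r, ∑ g : G d, v (ax x g y) ≤
        ∫ y in E \ ball x r, (Fintype.card (G d) * (v x - δ * r ^ 2) : ℝ) := by
      refine setIntegral_mono_on (int_good hci hb2)
        (int_good continuous_const hb2) (hEg.1.measurableSet.diff isOpen_ball.measurableSet) ?_
      intro y hy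
      refine (hpt y hy.1).trans ?_
      have h1 : r ≤ ‖y - x‖ := by
        have := hy.2
        rw [mem_ball, not_lt, dist_eq_norm] at this; exact this
      have h2 : r ^ 2 ≤ ‖y - x‖ ^ 2 := by gcongr
      have h3 := mul_le_mul_of_nonneg_left h2 hδ.le
      apply mul_le_mul_of_nonneg_left _ hN.le
      linarith
    refine this.trans_eq ?_
    rw [setIntegral_const, smul_eq_mul, mul_comm]
  have e3 : volume.real (E ∩ ball x r) + volume.real (E \ ball x r) = volume.real E :=
    measureReal_inter_add_sdiff isOpen_ball.measurableSet (good_lt_top hEg).ne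
  refine le_of_mul_le_mul_left ?_ hN
  rw [e1, ← e2]
  refine (add_le_add i1 i2).trans (le_of_eq ?_)
  rw [← e3]; ring

lemma E_meas {x : Pt d} {A E C C' : Set (Pt d)} {r κ : ℝ} (hA : GoodSet A) (hEg : GoodSet E)
    (hE : Inv x E) (hC : C = {y ∈ ball x r | ∀ g, ax x g y ∈ A})
    (hEC : Disjoint E C') (hm : volume.real (C \ C') ≤ κ) (hCb : IsBounded C) :
    volume.real (E ∩ ball x r) ≤ κ + Fintype.card (G d) * volume.real (E \ A) := by
  have hsub : E ∩ ball x r ⊆ (C \ C') ∪ ⋃ g ∈ (Finset.univ : Finset (G d)),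
      ax x g ⁻¹' (E \ A) := by
    intro y hy
    by_cases h : y ∈ C
    · exact Or.inl ⟨h, fun h' => hEC.le_bot ⟨hy.1, h'⟩⟩
    · right
      rw [hC] at h
      simp only [Set.mem_ofPred_eq, not_and, not_forall] at h
      obtain ⟨g, hg⟩ := h hy.2
      simp only [Set.mem_iUnion]
      exact ⟨g, Finset.mem_univ _, hE g y hy.1, hg⟩
  have hpre : ∀ g : G d, volume (ax x g ⁻¹' (E \ A)) = volume (E \ A) := fun g =>
    (ax_mp x g).measure_preimage (hEg.1.measurableSet.diff hA.1.measurableSet).nullMeasurableSet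
  have hfin : volume (E \ A) ≠ ⊤ := ((measure_mono Set.sdiff_subset).trans_lt (good_lt_top hEg)).ne
  have hfin2 : volume (C \ C') ≠ ⊤ :=
    ((measure_mono Set.sdiff_subset).trans_lt hCb.measure_lt_top).ne
  have hfin3 : volume (⋃ g ∈ (Finset.univ : Finset (G d)), ax x g ⁻¹' (E \ A)) ≠ ⊤ := by
    refine ((measure_biUnion_finset_le _ _).trans_lt ?_).ne
    simp only [hpre]
    exact ENNReal.sum_lt_top.2 fun _ _ => hfin.lt_top
  refine (measureReal_mono hsub (measure_union_ne_top hfin2 hfin3)).trans ?_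
  refine (measureReal_union_le _ _).trans (add_le_add hm ?_)
  refine (measureReal_biUnion_finset_le _ _).trans (le_of_eq ?_)
  simp only [Measure.real, hpre, Finset.sum_const, Finset.card_univ, nsmul_eq_mul]

lemma step [Nontrivial (Pt d)] (hax : SumAxioms d Φ)
    (hbulky : ∀ A B, GoodSet A → GoodSet B → Bulky (Φ A B)) {v : Pt d → ℝ}
    (hv : Continuous v) {Q : Set (Pt d)} (hQb : IsBounded Q) {θ δ r : ℝ} (hθ : 0 < θ)
    (hδ : 0 < δ) (hr : 0 < r)
    (hSM : ∀ x ∈ Q, ∀ z : Pt d, ‖z‖ ≤ 2 * r → ∑ g : G d, v (x + sg g z) ≤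
      Fintype.card (G d) * (v x - δ * ‖z‖ ^ 2)) (hT : TT Φ Q v θ) :
    ∃ γ > 0, ∃ ε₀ > 0, ∀ A, GoodSet A → ∀ x ε, 0 < ε → ε < ε₀ → ball x ε ⊆ A →
      Φ A (ball x ε) ⊆ Q → Df Φ v A (ball x ε) ≤ (θ - γ) * volume.real (ball x ε) := by
  have hN : (0 : ℝ) < Fintype.card (G d) := by exact_mod_cast Fintype.card_pos
  set N : ℝ := (Fintype.card (G d) : ℝ) with hNdef
  set γ := min (θ / N) (δ * r ^ 2) / 2 with hγ
  have hγ0 : 0 < γ := by positivity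
  have hγ1 : 2 * γ * N ≤ θ := by
    have : 2 * γ ≤ θ / N := by rw [hγ]; linarith [min_le_left (θ / N) (δ * r ^ 2)]
    rwa [le_div_iff₀ hN] at this
  have hγ2 : 2 * γ ≤ δ * r ^ 2 := by rw [hγ]; linarith [min_le_right (θ / N) (δ * r ^ 2)]
  obtain ⟨K, hK, hKs⟩ := sum_ball_subset hax
  have huc := hQb.isCompact_closure.uniformContinuousOn_of_continuous hv.continuousOn
  obtain ⟨ε₁, hε₁, hosc⟩ := Metric.uniformContinuousOn_iff.1 huc γ hγ0
  refine ⟨γ, hγ0, min ε₁ (r / K), lt_min hε₁ (by positivity), ?_⟩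
  intro A hA x ε hε hεlt hbA hQ
  have hAQ : A ⊆ Q := (hax.subset_sum _ _ hA (good_ball x ε)).trans hQ
  have hxQ : x ∈ Q := hAQ (hbA (mem_ball_self hε))
  set b := ball x ε with hb
  have hbg : GoodSet b := good_ball x ε
  set C := {y ∈ ball x r | ∀ g, ax x g y ∈ A} with hC
  have hCg : GoodSet C := by
    refine ⟨?_, isBounded_ball.subset (fun y hy => hy.1)⟩
    have : C = ball x r ∩ ⋂ g, ax x g ⁻¹' A := by ext y; simp [hC]
    rw [this]
    exact isOpen_ball.inter (isOpen_iInter_of_finite fun g =>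
      hA.1.preimage (ax x g).isometry.continuous)
  have hCi : Inv x C := by
    intro g y hy
    refine ⟨inv_ball x r g y hy.1, fun g' => ?_⟩
    obtain ⟨k, hk⟩ := ax_comp x g' g
    rw [hk]; exact hy.2 k
  have hCA : C ⊆ A := by
    intro y hy
    have := hy.2 (1, 1)
    rwa [ax_apply, sg_one, neg_add_cancel_right] at this
  apply le_of_forall_pos_le_add
  intro κ' hκ'
  set κ := κ' / (2 * γ) with hκ
  have hκ0 : 0 < κ := by positivity
  have hκ1 : 2 * γ * κ = κ' := by rw [hκ]; field_simp
  obtain ⟨C', hC'o, hC'c, hC'i, hC'n, hC'm⟩ := exists_shrink hCg hκ0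
  have hC'g : GoodSet C' := ⟨hC'o, hCg.2.subset (subset_closure.trans hC'c)⟩
  obtain ⟨hEg, hEΦ, hEm⟩ := exists_E hax hbulky hA hbg hC'g (hC'c.trans hCA) hC'n
  have hEi := E_inv hax hbg hC'g (inv_ball x ε) (hC'i x hCi)
  have hEsub : Φ C' b \ closure C' ⊆ ball x (2 * r) := by
    refine Set.sdiff_subset.trans ((mono2 hax hC'g (good_ball x r) hbg hbg ?_ subset_rfl).trans
      ((hKs x r ε hr hε).trans (ball_subset_ball ?_)))
    · exact (subset_closure.trans hC'c).trans fun y hy => hy.1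
    · have : ε ≤ r / K := hεlt.le.trans (min_le_right _ _)
      rw [le_div_iff₀ hK] at this
      linarith
  have hEd : Disjoint (Φ C' b \ closure C') C' :=
    Set.disjoint_sdiff_left.mono_right subset_closure
  set E := Φ C' b \ closure C' with hE
  have h1 := hT A E hA hEg (by rwa [← hEΦ])
  have h2 := integral_E_le hEg hEi hv hδ hr hEsub (hSM x hxQ)
  have h3 := E_meas hA hEg hEi hC hEd hC'm hCg.2
  have hbE : volume.real E = volume.real b := by simp only [Measure.real, hEm]
  have h4 : volume.real (E ∩ A) + volume.real (E \ A) = volume.real E :=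
    measureReal_inter_add_sdiff hA.1.measurableSet (good_lt_top hEg).ne
  have h5 : volume.real (E ∩ ball x r) + volume.real (E \ ball x r) = volume.real E :=
    measureReal_inter_add_sdiff isOpen_ball.measurableSet (good_lt_top hEg).ne
  have h6 : (v x - γ) * volume.real b ≤ ∫ y in b, v y := by
    have : ∫ y in b, (v x - γ) ≤ ∫ y in b, v y := by
      refine setIntegral_mono_on (int_good continuous_const hbg.2) (int_good hv hbg.2)
        hbg.1.measurableSet ?_
      intro y hy
      have := hosc x (subset_closure hxQ) y (subset_closure (hAQ (hbA hy))) (by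
        rw [dist_comm]; exact (mem_ball.1 hy).trans (hεlt.trans_le (min_le_left _ _)))
      rw [Real.dist_eq] at this
      have := (abs_lt.1 this).2
      linarith
    rwa [setIntegral_const, smul_eq_mul, mul_comm] at this
  unfold Df at h1 ⊢
  rw [← hEΦ, Set.inter_comm] at h1
  have p1 : 0 ≤ volume.real (E \ A) := measureReal_nonneg
  have p2 : 0 ≤ volume.real (E \ ball x r) := measureReal_nonneg
  rw [hbE] at h2 h4 h5
  have q1 := mul_le_mul_of_nonneg_right hγ1 p1
  have q2 := mul_le_mul_of_nonneg_right hγ2 p2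
  have q3 : 2 * γ * volume.real b ≤ 2 * γ * (κ + N * volume.real (E \ A) +
      volume.real (E \ ball x r)) := mul_le_mul_of_nonneg_left (by linarith) (by positivity)
  have q4 : volume.real (E ∩ A) = volume.real b - volume.real (E \ A) := by linarith
  rw [q4] at h1
  nlinarith

theorem main_comb [Nontrivial (Pt d)] (hax : SumAxioms d Φ)
    (hbulky : ∀ A B, GoodSet A → GoodSet B → Bulky (Φ A B)) {v : Pt d → ℝ}
    (hv : Continuous v) {Q : Set (Pt d)} (hQb : IsBounded Q) {δ r : ℝ}
    (hδ : 0 < δ) (hr : 0 < r)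
    (hSM : ∀ x ∈ Q, ∀ z : Pt d, ‖z‖ ≤ 2 * r → ∑ g : G d, v (x + sg g z) ≤
      Fintype.card (G d) * (v x - δ * ‖z‖ ^ 2)) :
    ∀ A B, GoodSet A → GoodSet B → Φ A B ⊆ Q →
      ∫ y in Φ A B, v y ≤ (∫ y in A, v y) + ∫ y in B, v y := by
  obtain ⟨M, hM⟩ : ∃ M, ∀ y ∈ Q, |v y| ≤ M := by
    obtain ⟨M, hM⟩ := hQb.isCompact_closure.exists_bound_of_continuousOn hv.continuousOn
    exact ⟨M, fun y hy => hM y (subset_closure hy)⟩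
  set S := {θ : ℝ | 0 ≤ θ ∧ TT Φ Q v θ} with hS
  have hSne : S.Nonempty := by
    refine ⟨2 * |M|, by positivity, Df_gen hax hv fun y hy => (hM y hy).trans (le_abs_self M)⟩
  have hSb : BddBelow S := ⟨0, fun θ hθ => hθ.1⟩
  have h0 : 0 ≤ sInf S := le_csInf hSne fun θ hθ => hθ.1
  have hTinf : TT Φ Q v (sInf S) := by
    intro A B hA hB hQ
    by_contra hcon
    push Not at hcon
    have hm : 0 ≤ volume.real (A ∩ B) := measureReal_nonneg
    have hle : ∀ η > 0, Df Φ v A B ≤ (sInf S + η) * volume.real (A ∩ B) := by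
      intro η hη
      obtain ⟨θ, hθ, hlt⟩ := exists_lt_of_csInf_lt hSne (show sInf S < sInf S + η by linarith)
      exact (hθ.2 A B hA hB hQ).trans (mul_le_mul_of_nonneg_right hlt.le hm)
    set g := Df Φ v A B - sInf S * volume.real (A ∩ B) with hg
    have hgpos : 0 < g := by linarith
    have := hle (g / (2 * (volume.real (A ∩ B) + 1))) (by positivity)
    have h2 : g / (2 * (volume.real (A ∩ B) + 1)) * volume.real (A ∩ B) ≤ g / 2 := by
      rw [div_mul_eq_mul_div, div_le_div_iff₀ (by positivity) (by positivity)]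
      nlinarith
    linarith
  have hz : sInf S = 0 := by
    by_contra hne
    have hpos : 0 < sInf S := lt_of_le_of_ne h0 (Ne.symm hne)
    obtain ⟨γ, hγ, ε₀, hε₀, H⟩ := step hax hbulky hv hQb hpos hδ hr hSM hTinf
    have hT2 : TT Φ Q v (max (sInf S - γ) 0) := by
      refine TT_of_balls hax hbulky hv hM (le_max_right _ _) hε₀ ?_
      intro A hA x ε hε hεl hbA hQ
      exact (H A hA x ε hε hεl hbA hQ).trans
        (mul_le_mul_of_nonneg_right (le_max_left _ _) measureReal_nonneg)
    have := csInf_le hSb (show max (sInf S - γ) 0 ∈ S from ⟨le_max_right _ _, hT2⟩)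
    have h3 : max (sInf S - γ) 0 < sInf S := max_lt (by linarith) hpos
    linarith
  intro A B hA hB hQ
  have := hTinf A B hA hB hQ
  rw [hz, zero_mul] at this
  unfold Df at this
  linarith

end SumQD
end

section
open MeasureTheory Metric Bornology

namespace SumQD

variable {d : ℕ}

lemma taylorA {E F : Type*} [NormedAddCommGroup E] [NormedSpace ℝ E] [NormedAddCommGroup F]
    [NormedSpace ℝ F] {f : E → F} (hf : Differentiable ℝ f) {K : ℝ} (hK0 : 0 ≤ K)
    (hK : ∀ x y, ‖fderiv ℝ f x - fderiv ℝ f y‖ ≤ K * ‖x - y‖) (p u : E) :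
    ‖f (p + u) - f p - fderiv ℝ f p u‖ ≤ K * ‖u‖ * ‖u‖ := by
  have := Convex.norm_image_sub_le_of_norm_hasFDerivWithin_le' (𝕜 := ℝ)
      (f := f) (f' := fderiv ℝ f) (φ := fderiv ℝ f p)
      (s := closedBall p ‖u‖) (x := p) (y := p + u) (C := K * ‖u‖)
      (fun x _ => (hf x).hasFDerivAt.hasFDerivWithinAt)
      (fun x hx => (hK x p).trans (mul_le_mul_of_nonneg_left (mem_closedBall_iff_norm.1 hx) hK0))
      (convex_closedBall _ _) (by simp) (by simp)
  simpa using this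

lemma taylorB {E : Type*} [NormedAddCommGroup E] [NormedSpace ℝ E] {φ : E → ℝ}
    (hd0 : Differentiable ℝ φ) (B : E →L[ℝ] E →L[ℝ] ℝ) (p : E) {K : ℝ} (hK0 : 0 ≤ K)
    (hsym : ∀ u w, B u w = B w u)
    (b1 : ∀ u, ‖fderiv ℝ φ (p + u) - fderiv ℝ φ p - B u‖ ≤ K * ‖u‖ * ‖u‖) (w : E) :
    |φ (p + w) - φ p - fderiv ℝ φ p w - (1 / 2) * B w w| ≤ K * ‖w‖ ^ 3 := by
  have hF : ∀ u : E, HasFDerivAt (fun u => φ (p + u) - (1 / 2) * B u u)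
      (fderiv ℝ φ (p + u) - B u) u := by
    intro u
    have e1 : HasFDerivAt (fun u => φ (p + u)) (fderiv ℝ φ (p + u)) u :=
      (hasFDerivAt_comp_add_left p).2 (hd0 (p + u)).hasFDerivAt
    have e2 : HasFDerivAt (fun u => B u u) ((B u).comp (ContinuousLinearMap.id ℝ E) +
        (B.flip u)) u := by
      exact (B.hasFDerivAt (x := u)).clm_apply (hasFDerivAt_id u)
    have e3 := e1.sub (e2.const_mul (1 / 2))
    refine e3.congr_fderiv ?_
    ext w'
    simp [hsym w' u]
    ring
  have := Convex.norm_image_sub_le_of_norm_hasFDerivWithin_le' (𝕜 := ℝ)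
      (f := fun u => φ (p + u) - (1 / 2) * B u u) (f' := fun u => fderiv ℝ φ (p + u) - B u)
      (φ := fderiv ℝ φ p)
      (s := closedBall 0 ‖w‖) (x := 0) (y := w) (C := K * ‖w‖ * ‖w‖)
      (fun x _ => (hF x).hasFDerivWithinAt)
      (fun x hx => by
        have hx' : ‖x‖ ≤ ‖w‖ := by simpa using hx
        have := b1 x
        rw [sub_right_comm] at this
        refine this.trans ?_
        gcongr)
      (convex_closedBall _ _) (by simp) (by simp)
  simp only [add_zero, map_zero, mul_zero, sub_zero, Real.norm_eq_abs] at this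
  refine le_trans (le_of_eq ?_) (this.trans_eq ?_)
  · congr 1; ring
  · ring

open scoped ContDiff in
lemma taylorC {E : Type*} [NormedAddCommGroup E] [NormedSpace ℝ E] {φ : E → ℝ}
    (hφ : ContDiff ℝ ∞ φ) (p : E) (u w : E) :
    fderiv ℝ (fderiv ℝ φ) p u w = fderiv ℝ (fderiv ℝ φ) p w u := by
  have : IsSymmSndFDerivAt ℝ φ p := hφ.contDiffAt.isSymmSndFDerivAt (by
    rw [minSmoothness_of_isRCLikeNormedField]
    exact WithTop.coe_le_coe.2 le_top)
  exact this.eq u w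

open scoped ContDiff in
lemma taylorD {E F : Type*} [NormedAddCommGroup E] [NormedSpace ℝ E] [NormedAddCommGroup F]
    [NormedSpace ℝ F] {f : E → F}
    (hφ : ContDiff ℝ ∞ f) (hc : HasCompactSupport f) :
    ∃ K : ℝ, 0 ≤ K ∧ ∀ x y, ‖f x - f y‖ ≤ K * ‖x - y‖ := by
  obtain ⟨K, hK⟩ := ContDiff.lipschitzWith_of_hasCompactSupport hc hφ (by simp)
  refine ⟨K, K.coe_nonneg, fun x y => ?_⟩
  have := hK.dist_le_mul x y
  rwa [dist_eq_norm, dist_eq_norm] at this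

open scoped ContDiff in
lemma taylor2 {E : Type*} [NormedAddCommGroup E] [NormedSpace ℝ E] {φ : E → ℝ}
    (hφ : ContDiff ℝ ∞ φ) (hc : HasCompactSupport φ) :
    ∃ C : ℝ, 0 ≤ C ∧ ∀ p w : E,
      |φ (p + w) - φ p - fderiv ℝ φ p w - (1 / 2) * fderiv ℝ (fderiv ℝ φ) p w w| ≤
        C * ‖w‖ ^ 3 := by
  have h1 : ContDiff ℝ ∞ (fderiv ℝ φ) := hφ.fderiv_right (m := ∞) le_rfl
  have h2 : ContDiff ℝ ∞ (fderiv ℝ (fderiv ℝ φ)) := h1.fderiv_right (m := ∞) le_rfl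
  have hc2 : HasCompactSupport (fderiv ℝ (fderiv ℝ φ)) := (hc.fderiv ℝ).fderiv ℝ
  obtain ⟨K, hK0, hK⟩ := taylorD h2 hc2
  have hd0 : Differentiable ℝ φ := hφ.differentiable (by simp)
  have hd1 : Differentiable ℝ (fderiv ℝ φ) := h1.differentiable (by simp)
  exact ⟨K, hK0, fun p w => taylorB hd0 _ p hK0 (taylorC hφ p) (taylorA hd1 hK0 hK p) w⟩

/-- second moments of signed permutations -/
lemma sum_sq (z : Pt d) (i : Fin d) :
    (d : ℝ) * ∑ g : G d, (sg g z i) * (sg g z i) = Fintype.card (G d) * ‖z‖ ^ 2 := by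
  have hconst : ∀ j : Fin d, ∑ g : G d, (sg g z j) * (sg g z j) =
      ∑ g : G d, (sg g z i) * (sg g z i) := by
    intro j
    refine Fintype.sum_equiv ((Equiv.mulRight (Equiv.swap i j)).prodCongr (Equiv.refl _)) _ _ ?_
    rintro ⟨σ, ε⟩
    simp only [sg_apply, Equiv.prodCongr_apply, Prod.map, Equiv.coe_mulRight, Equiv.refl_apply,
      Equiv.Perm.mul_apply, Equiv.swap_apply_left]
    rw [mul_mul_mul_comm, unit_sq, mul_mul_mul_comm, unit_sq]
  have h1 : ∑ j : Fin d, ∑ g : G d, (sg g z j) * (sg g z j) = Fintype.card (G d) * ‖z‖ ^ 2 := by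
    rw [Finset.sum_comm]
    have : ∀ g : G d, ∑ j, (sg g z j) * (sg g z j) = ‖z‖ ^ 2 := by
      intro g
      rw [← (sg g).norm_map z, EuclideanSpace.norm_sq_eq]
      refine Finset.sum_congr rfl fun j _ => ?_
      rw [Real.norm_eq_abs, sq_abs, sq]
    simp only [this, Finset.sum_const, Finset.card_univ, nsmul_eq_mul]
  rw [← h1]
  simp only [hconst, Finset.sum_const, Finset.card_univ, nsmul_eq_mul, Fintype.card_fin]

lemma sum_cross (z : Pt d) {i j : Fin d} (hij : i ≠ j) :
    ∑ g : G d, (sg g z i) * (sg g z j) = 0 := by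
  have : ∑ g : G d, (sg g z i) * (sg g z j) = ∑ g : G d, -((sg g z i) * (sg g z j)) := by
    refine Fintype.sum_equiv ((Equiv.refl _).prodCongr
      (Equiv.mulRight (Pi.mulSingle i (-1)))) _ _ ?_
    rintro ⟨σ, ε⟩
    simp [sg_apply, Pi.mulSingle_eq_of_ne hij.symm]
  rw [Finset.sum_neg_distrib] at this
  linarith

lemma sum_lin (ℓ : Pt d →L[ℝ] ℝ) (z : Pt d) : ∑ g : G d, ℓ (sg g z) = 0 := by
  have : ∑ g : G d, ℓ (sg g z) = ∑ g : G d, -ℓ (sg g z) := by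
    refine Fintype.sum_equiv ((Equiv.refl _).prodCongr
      (Equiv.mulRight (fun _ => -1))) _ _ ?_
    rintro ⟨σ, ε⟩
    have : sg (σ, ε * fun _ => -1) z = - sg (σ, ε) z := by
      ext i; simp [sg_apply]
    simp [this]
  rw [Finset.sum_neg_distrib] at this
  linarith

lemma sum_bilin [Nontrivial (Pt d)] (B : Pt d →L[ℝ] Pt d →L[ℝ] ℝ) (z : Pt d) :
    ∑ g : G d, B (sg g z) (sg g z) = (Fintype.card (G d) / d *
      ∑ i, B (EuclideanSpace.single i 1) (EuclideanSpace.single i 1)) * ‖z‖ ^ 2 := by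
  have hd : (d : ℝ) ≠ 0 := by
    intro h
    have : d = 0 := by exact_mod_cast h
    subst this
    exact not_subsingleton (Pt 0) inferInstance
  have hexp : ∀ w : Pt d, B w w = ∑ i, ∑ j, (w i * w j) *
      B (EuclideanSpace.single i 1) (EuclideanSpace.single j 1) := by
    intro w
    have hw : w = ∑ i, w i • EuclideanSpace.single i (1 : ℝ) := by
      ext j
      simp [Finset.sum_apply, Pi.single_apply]
    conv_lhs => rw [hw]
    simp only [map_sum, _root_.sum_apply, map_smul, _root_.smul_apply,
      smul_eq_mul, Finset.mul_sum]
    rw [Finset.sum_comm]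
    refine Finset.sum_congr rfl fun i _ => Finset.sum_congr rfl fun j _ => ?_
    ring
  rw [Finset.sum_congr rfl fun g _ => hexp (sg g z), Finset.sum_comm]
  have : ∀ i : Fin d, ∑ g : G d, ∑ j, (sg g z i * sg g z j) *
      B (EuclideanSpace.single i 1) (EuclideanSpace.single j 1) =
      (Fintype.card (G d) * ‖z‖ ^ 2 / d) *
        B (EuclideanSpace.single i 1) (EuclideanSpace.single i 1) := by
    intro i
    rw [Finset.sum_comm, Finset.sum_eq_single i]
    · rw [← Finset.sum_mul, ← sum_sq z i]
      field_simp
    · intro j _ hj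
      rw [← Finset.sum_mul, sum_cross z hj.symm, zero_mul]
    · simp
  rw [Finset.sum_congr rfl fun i _ => this i, ← Finset.mul_sum]
  ring

open scoped ContDiff in
lemma taylor_avg [Nontrivial (Pt d)] {φ : Pt d → ℝ} (hφ : ContDiff ℝ ∞ φ)
    (hc : HasCompactSupport φ) :
    ∃ (ℓ : Pt d → ℝ) (C : ℝ), Continuous ℓ ∧ HasCompactSupport ℓ ∧ 0 ≤ C ∧ ∀ p z : Pt d,
      |∑ g : G d, φ (p + sg g z) - Fintype.card (G d) * φ p - ℓ p * ‖z‖ ^ 2| ≤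
        C * ‖z‖ ^ 3 := by
  obtain ⟨C, hC, h⟩ := taylor2 hφ hc
  have h1 : ContDiff ℝ ∞ (fderiv ℝ φ) := hφ.fderiv_right (m := ∞) le_rfl
  have h2 : ContDiff ℝ ∞ (fderiv ℝ (fderiv ℝ φ)) := h1.fderiv_right (m := ∞) le_rfl
  have hcont : Continuous (fderiv ℝ (fderiv ℝ φ)) := h2.continuous
  have hc2 : HasCompactSupport (fderiv ℝ (fderiv ℝ φ)) := (hc.fderiv ℝ).fderiv ℝ
  refine ⟨fun p => (1 / 2) * (Fintype.card (G d) / d *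
      ∑ i, fderiv ℝ (fderiv ℝ φ) p (EuclideanSpace.single i 1) (EuclideanSpace.single i 1)),
      Fintype.card (G d) * C, by fun_prop, ?_, by positivity, ?_⟩
  · refine hc2.mono' ?_
    intro p hp
    apply subset_tsupport
    intro h0
    apply hp
    simp [h0]
  · intro p z
    have e : ∑ g : G d, φ (p + sg g z) - Fintype.card (G d) * φ p -
        ((1 / 2) * (Fintype.card (G d) / d *
      ∑ i, fderiv ℝ (fderiv ℝ φ) p (EuclideanSpace.single i 1) (EuclideanSpace.single i 1))) *
        ‖z‖ ^ 2 = ∑ g : G d, (φ (p + sg g z) - φ p - fderiv ℝ φ p (sg g z) -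
          (1 / 2) * fderiv ℝ (fderiv ℝ φ) p (sg g z) (sg g z)) := by
      rw [Finset.sum_sub_distrib, Finset.sum_sub_distrib, Finset.sum_sub_distrib, sum_lin,
        ← Finset.mul_sum, sum_bilin]
      simp only [Finset.sum_const, Finset.card_univ, nsmul_eq_mul]
      ring
    rw [e]
    refine (Finset.abs_sum_le_sum_abs _ _).trans ?_
    have : ∀ g ∈ (Finset.univ : Finset (G d)), |φ (p + sg g z) - φ p - fderiv ℝ φ p (sg g z) -
          (1 / 2) * fderiv ℝ (fderiv ℝ φ) p (sg g z) (sg g z)| ≤ C * ‖z‖ ^ 3 := by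
      intro g _
      have := h p (sg g z)
      rwa [(sg g).norm_map] at this
    refine (Finset.sum_le_sum this).trans_eq ?_
    simp only [Finset.sum_const, Finset.card_univ, nsmul_eq_mul]
    ring

lemma avg_normsq (x z : Pt d) : ∑ g : G d, ‖x + sg g z‖ ^ 2 =
    Fintype.card (G d) * (‖x‖ ^ 2 + ‖z‖ ^ 2) := by
  have : ∀ g : G d, ‖x + sg g z‖ ^ 2 = ‖x‖ ^ 2 + 2 * innerSL ℝ x (sg g z) + ‖z‖ ^ 2 := by
    intro g
    rw [norm_add_sq_real, (sg g).norm_map]; rfl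
  simp only [this]
  rw [Finset.sum_add_distrib, Finset.sum_add_distrib, ← Finset.mul_sum, sum_lin]
  simp only [Finset.sum_const, Finset.card_univ, nsmul_eq_mul]
  ring

end SumQD
end

section
open MeasureTheory Metric Bornology Filter Topology
open scoped ContDiff

namespace SumQD

variable {d : ℕ}

/-- mollification -/
noncomputable def mol (f φ : Pt d → ℝ) (x : Pt d) : ℝ := ∫ y, f y * φ (x - y)

lemma int_mul {f ψ : Pt d → ℝ} (hf : Continuous f) (hfc : HasCompactSupport f)
    (hψ : Continuous ψ) : Integrable (fun y => f y * ψ y) :=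
  (hf.mul hψ).integrable_of_hasCompactSupport hfc.mul_right

lemma mol_continuous {f φ : Pt d → ℝ} (hf : Continuous f) (hφ : Continuous φ)
    (hφc : HasCompactSupport φ) : Continuous (mol f φ) :=
  hφc.continuous_convolution_right (ContinuousLinearMap.mul ℝ ℝ) hf.locallyIntegrable hφ

lemma mol_shift (f φ : Pt d → ℝ) (x z : Pt d) :
    mol f φ (x + z) = ∫ y, f (y + z) * φ (x - y) := by
  unfold mol
  rw [← integral_add_right_eq_self (fun y => f y * φ (x + z - y)) z]
  refine integral_congr_ae (Eventually.of_forall fun y => ?_)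
  simp

lemma mol_taylor [Nontrivial (Pt d)] {f φ : Pt d → ℝ} (hf : Continuous f)
    (hfc : HasCompactSupport f) (hφ : ContDiff ℝ ∞ φ) (hφc : HasCompactSupport φ) :
    ∃ (L : Pt d → ℝ) (C : ℝ), 0 ≤ C ∧ ∀ x z : Pt d,
      |∑ g : G d, mol f φ (x + sg g z) - Fintype.card (G d) * mol f φ x - L x * ‖z‖ ^ 2| ≤
        C * ‖z‖ ^ 3 := by
  obtain ⟨ℓ, C, hℓ, -, hC, h⟩ := taylor_avg hφ hφc
  have hfi : Integrable f := hf.integrable_of_hasCompactSupport hfc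
  have hφ0 := hφ.continuous
  refine ⟨mol f ℓ, C * ∫ y, |f y|, mul_nonneg hC (integral_nonneg fun y => abs_nonneg _),
    fun x z => ?_⟩
  have i1 : ∀ w, Integrable (fun y => f y * φ (w - y)) := fun w =>
    int_mul hf hfc (by fun_prop)
  have i2 : Integrable (fun y => f y * ℓ (x - y)) := int_mul hf hfc (by fun_prop)
  have e : ∑ g : G d, mol f φ (x + sg g z) - Fintype.card (G d) * mol f φ x -
      mol f ℓ x * ‖z‖ ^ 2 = ∫ y, f y * (∑ g : G d, φ (x - y + sg g z) -
        Fintype.card (G d) * φ (x - y) - ℓ (x - y) * ‖z‖ ^ 2) := by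
    unfold mol
    rw [← integral_finsetSum _ (fun g _ => i1 _), ← integral_const_mul, ← integral_mul_const,
      ← integral_sub (integrable_finsetSum _ (fun g _ => i1 _)) ((i1 x).const_mul _),
      ← integral_sub _ (i2.mul_const _)]
    · refine integral_congr_ae (Eventually.of_forall fun y => ?_)
      simp only [mul_sub, Finset.mul_sum]
      congr 1
      · congr 1
        · refine Finset.sum_congr rfl fun g _ => ?_
          congr 2; abel
        · ring
      · ring
    · exact (integrable_finsetSum _ (fun g _ => i1 _)).sub ((i1 x).const_mul _)
  rw [e, ← Real.norm_eq_abs]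
  refine (norm_integral_le_of_norm_le (g := fun y => |f y| * (C * ‖z‖ ^ 3))
    (hfi.abs.mul_const _) (Eventually.of_forall fun y => ?_)).trans_eq ?_
  · rw [norm_mul, Real.norm_eq_abs, Real.norm_eq_abs]
    exact mul_le_mul_of_nonneg_left (h _ _) (abs_nonneg _)
  · rw [integral_mul_const]; ring

/-- second moment of the ball -/
noncomputable def JJ (d : ℕ) (r : ℝ) : ℝ := ∫ z in ball (0 : Pt d) r, ‖z‖ ^ 2

lemma JJ_pos [Nontrivial (Pt d)] {r : ℝ} (hr : 0 < r) : 0 < JJ d r := by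
  unfold JJ
  rw [setIntegral_pos_iff_support_of_nonneg_ae]
  · have : (ball (0 : Pt d) r \ {0}) ⊆ Function.support (fun z : Pt d => ‖z‖ ^ 2) ∩ ball 0 r := by
      intro z hz
      refine ⟨?_, hz.1⟩
      have : z ≠ 0 := hz.2
      simp [this]
    refine lt_of_lt_of_le ?_ (measure_mono this)
    rw [measure_sdiff_null (measure_singleton _)]
    exact measure_ball_pos _ _ hr
  · exact Eventually.of_forall fun z => by positivity
  · exact int_good (by fun_prop) isBounded_ball

lemma ball_sg {v : Pt d → ℝ} (g : G d) (r : ℝ) :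
    ∫ z in ball (0 : Pt d) r, v (sg g z) = ∫ z in ball (0 : Pt d) r, v z := by
  have := (sg g).measurePreserving.setIntegral_preimage_emb
    (sg g).toHomeomorph.measurableEmbedding v (ball 0 r)
  rwa [LinearIsometryEquiv.preimage_ball, map_zero] at this

noncomputable def gg (f : Pt d → ℝ) (r : ℝ) (y : Pt d) : ℝ :=
  ∫ z in ball (0 : Pt d) r, (f (y + z) - f y)

lemma gg_le {f : Pt d → ℝ} (hf : Continuous f) {k r : ℝ} {y : Pt d}
    (H : ∀ z : Pt d, ‖z‖ < r → f (y + z) + f (y - z) ≤ 2 * f y + 2 * k * ‖z‖ ^ 2) :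
    gg f r y ≤ k * JJ d r := by
  have e1 : ∫ z in ball (0 : Pt d) r, (f (y - z) - f y) = gg f r y := by
    have := ball_sg (v := fun z => f (y + z) - f y) (1, fun _ => -1) r
    simp only [sg_neg, ← sub_eq_add_neg] at this
    exact this
  have i1 : IntegrableOn (fun z => f (y + z) - f y) (ball (0 : Pt d) r) :=
    int_good (by fun_prop) isBounded_ball
  have i2 : IntegrableOn (fun z => f (y - z) - f y) (ball (0 : Pt d) r) :=
    int_good (by fun_prop) isBounded_ball
  have e2 : gg f r y + gg f r y ≤ ∫ z in ball (0 : Pt d) r, 2 * k * ‖z‖ ^ 2 := by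
    have e3 : gg f r y + gg f r y =
        ∫ z in ball (0:Pt d) r, ((f (y - z) - f y) + (f (y + z) - f y)) := by
      rw [integral_add i2 i1, e1]; rfl
    rw [e3]
    refine setIntegral_mono_on (i2.add i1) (int_good (by fun_prop) isBounded_ball)
      isOpen_ball.measurableSet ?_
    intro z hz
    have := H z (by simpa using hz)
    linarith
  rw [integral_const_mul] at e2
  unfold JJ
  linarith

lemma mol_fubini {f φ : Pt d → ℝ} (hf : Continuous f)
    (hfc : HasCompactSupport f) (hφ : Continuous φ) (hφc : HasCompactSupport φ) (x : Pt d)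
    (r : ℝ) :
    ∫ z in ball (0 : Pt d) r, (mol f φ (x + z) - mol f φ x) = ∫ y, gg f r y * φ (x - y) := by
  obtain ⟨M, hM⟩ := hfc.exists_bound_of_continuous hf
  have hφx : HasCompactSupport fun y => φ (x - y) :=
    hφc.comp_homeomorph (Homeomorph.subLeft x)
  have hφi : Integrable fun y => φ (x - y) :=
    (by fun_prop : Continuous fun y => φ (x - y)).integrable_of_hasCompactSupport hφx
  have i1 : ∀ z, Integrable (fun y => f (y + z) * φ (x - y)) := fun z =>
    ((by fun_prop : Continuous fun y => f (y + z)).mul (by fun_prop)).integrable_of_hasCompactSupport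
      hφx.mul_left
  have e1 : ∀ z, mol f φ (x + z) - mol f φ x = ∫ y, (f (y + z) - f y) * φ (x - y) := by
    intro z
    rw [mol_shift]
    have h0 := i1 0
    simp only [add_zero] at h0
    unfold mol
    rw [← integral_sub (i1 z) h0]
    simp only [sub_mul]
  simp only [e1]
  rw [integral_integral_swap]
  · refine integral_congr_ae (Eventually.of_forall fun y => ?_)
    simp only [gg]
    rw [integral_mul_const]
  · have : IsFiniteMeasure (volume.restrict (ball (0 : Pt d) r)) :=
      ⟨by rw [Measure.restrict_apply_univ]; exact measure_ball_lt_top⟩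
    have hb := (integrable_const (μ := volume.restrict (ball (0 : Pt d) r)) (2 * M)).mul_prod
      hφi.norm
    refine hb.mono' ?_ (Eventually.of_forall fun p => ?_)
    · apply Continuous.aestronglyMeasurable
      unfold Function.uncurry
      fun_prop
    · unfold Function.uncurry
      rw [norm_mul]
      refine mul_le_mul_of_nonneg_right ?_ (norm_nonneg _)
      refine (norm_sub_le _ _).trans ?_
      linarith [hM (p.2 + p.1), hM p.2]

lemma gg_measurable {f : Pt d → ℝ} (hf : Continuous f) (r : ℝ) :
    StronglyMeasurable (gg f r) := by
  have hc : Continuous (fun p : Pt d × Pt d => f (p.1 + p.2) - f p.1) := by fun_prop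
  exact hc.stronglyMeasurable.integral_prod_right' (ν := volume.restrict (ball (0 : Pt d) r))

lemma L_nonpos [Nontrivial (Pt d)] {f φ : Pt d → ℝ} (hf : Continuous f)
    (hfc : HasCompactSupport f) (hφ : Continuous φ) (hφc : HasCompactSupport φ)
    (hφ0 : ∀ y, 0 ≤ φ y) {h k ρ : ℝ} (hφh : Function.support φ ⊆ ball 0 h) (hk : 0 ≤ k)
    (hρ : 0 < ρ) (x : Pt d)
    (H1 : ∀ y, dist x y < h → ∀ z : Pt d, ‖z‖ < ρ →
      f (y + z) + f (y - z) ≤ 2 * f y + 2 * k * ‖z‖ ^ 2)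
    (H2 : ∀ y, dist x y < h → ∃ r₀ > 0, ∀ r, 0 < r → r < r₀ → gg f r y ≤ 0)
    {L C : ℝ} (hC : 0 ≤ C) (HT : ∀ z : Pt d,
      |∑ g : G d, mol f φ (x + sg g z) - Fintype.card (G d) * mol f φ x - L * ‖z‖ ^ 2| ≤
        C * ‖z‖ ^ 3) : L ≤ 0 := by
  have hN : (0 : ℝ) < Fintype.card (G d) := by exact_mod_cast Fintype.card_pos
  set N : ℝ := (Fintype.card (G d) : ℝ) with hNdef
  have hvc := mol_continuous hf hφ hφc
  have A1 : ∀ r, 0 < r → (L - C * r) * JJ d r ≤ N * ∫ y, gg f r y * φ (x - y) := by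
    intro r hr
    rw [← mol_fubini hf hfc hφ hφc]
    have i0 : ∀ g : G d, IntegrableOn (fun z => mol f φ (x + sg g z) - mol f φ x)
        (ball (0 : Pt d) r) := by
      intro g
      refine int_good ?_ isBounded_ball
      have := (sg g).continuous
      fun_prop
    have e : N * ∫ z in ball (0 : Pt d) r, (mol f φ (x + z) - mol f φ x) =
        ∫ z in ball (0 : Pt d) r, ∑ g : G d, (mol f φ (x + sg g z) - mol f φ x) := by
      rw [integral_finsetSum _ (fun g _ => i0 g)]
      have : ∀ g : G d, ∫ z in ball (0 : Pt d) r, (mol f φ (x + sg g z) - mol f φ x) =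
          ∫ z in ball (0 : Pt d) r, (mol f φ (x + z) - mol f φ x) := fun g =>
        ball_sg (v := fun z => mol f φ (x + z) - mol f φ x) g r
      simp only [this, Finset.sum_const, Finset.card_univ, nsmul_eq_mul, hNdef]
    rw [e]
    unfold JJ
    rw [← integral_const_mul]
    refine setIntegral_mono_on (int_good (by fun_prop) isBounded_ball)
      (integrable_finsetSum _ fun g _ => i0 g) isOpen_ball.measurableSet ?_
    intro z hz
    have hz' : ‖z‖ < r := by simpa using hz
    have := (abs_le.1 (HT z)).1
    simp only [Finset.sum_sub_distrib, Finset.sum_const, Finset.card_univ, nsmul_eq_mul]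
    have h3 : C * ‖z‖ ^ 3 ≤ C * r * ‖z‖ ^ 2 := by
      have : C * ‖z‖ ^ 3 = C * ‖z‖ * ‖z‖ ^ 2 := by ring
      rw [this]; gcongr
    linarith
  set rn : ℕ → ℝ := fun n => ρ / (n + 1) with hrn
  have hrn0 : ∀ n, 0 < rn n := fun n => by positivity
  have hrnρ : ∀ n, rn n ≤ ρ := fun n => div_le_self hρ.le (by
    have : (0 : ℝ) ≤ n := Nat.cast_nonneg n
    linarith)
  have hrnlim : Tendsto rn atTop (𝓝 0) := by
    have := tendsto_one_div_add_atTop_nhds_zero_nat (𝕜 := ℝ)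
    have := this.const_mul ρ
    simpa [hrn, div_eq_mul_inv] using this
  have hφx : HasCompactSupport fun y => φ (x - y) :=
    hφc.comp_homeomorph (Homeomorph.subLeft x)
  have hφi : Integrable fun y => φ (x - y) :=
    (by fun_prop : Continuous fun y => φ (x - y)).integrable_of_hasCompactSupport hφx
  have hdist : ∀ y, φ (x - y) ≠ 0 → dist x y < h := by
    intro y hy
    have := hφh (Function.mem_support.2 hy)
    rwa [mem_ball_zero_iff, ← dist_eq_norm] at this
  set F : ℕ → Pt d → ℝ := fun n y => max (gg f (rn n) y / JJ d (rn n)) 0 * φ (x - y) with hF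
  have hFmeas : ∀ n, AEStronglyMeasurable (F n) volume := by
    intro n
    refine AEStronglyMeasurable.mul ?_ hφi.1
    have h1 := (gg_measurable hf (rn n)).measurable
    exact ((h1.div_const _).max measurable_const).aestronglyMeasurable
  have hFb : ∀ n y, ‖F n y‖ ≤ k * φ (x - y) := by
    intro n y
    rw [hF]
    simp only
    rw [norm_mul, Real.norm_of_nonneg (le_max_right _ _), Real.norm_of_nonneg (hφ0 _)]
    by_cases hy : φ (x - y) = 0
    · simp [hy]
    · refine mul_le_mul_of_nonneg_right (max_le ?_ hk) (hφ0 _)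
      rw [div_le_iff₀ (JJ_pos (hrn0 n))]
      exact gg_le hf fun z hz => H1 y (hdist y hy) z (hz.trans_le (hrnρ n))
  have hFlim : ∀ y, Tendsto (fun n => F n y) atTop (𝓝 0) := by
    intro y
    by_cases hy : φ (x - y) = 0
    · simp [hF, hy]
    · obtain ⟨r₀, hr₀, hr⟩ := H2 y (hdist y hy)
      refine tendsto_const_nhds.congr' ?_
      filter_upwards [hrnlim.eventually (gt_mem_nhds hr₀)] with n hn
      rw [hF]
      simp only
      rw [max_eq_right, zero_mul]
      exact div_nonpos_of_nonpos_of_nonneg (hr _ (hrn0 n) hn) (JJ_pos (hrn0 n)).le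
  have hlim := tendsto_integral_of_dominated_convergence (fun y => k * φ (x - y)) hFmeas
    (hφi.const_mul k) (fun n => Eventually.of_forall (hFb n)) (Eventually.of_forall hFlim)
  rw [integral_zero] at hlim
  have hFi : ∀ n, Integrable (F n) := fun n =>
    (hφi.const_mul k).mono' (hFmeas n) (Eventually.of_forall (hFb n))
  have key : ∀ n, L - C * rn n ≤ N * ∫ y, F n y := by
    intro n
    have hJ := JJ_pos (d := d) (hrn0 n)
    have h1 := A1 (rn n) (hrn0 n)
    refine le_of_mul_le_mul_right (h1.trans ?_) hJ
    rw [mul_assoc]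
    refine mul_le_mul_of_nonneg_left ?_ hN.le
    rw [← integral_mul_const]
    obtain ⟨M, hM⟩ := hfc.exists_bound_of_continuous hf
    refine integral_mono ?_ ((hFi n).mul_const _) ?_
    · refine hφi.bdd_mul (c := (2 * M) * volume.real (ball (0 : Pt d) (rn n)))
        (gg_measurable hf _).aestronglyMeasurable (Eventually.of_forall fun y => ?_)
      refine norm_setIntegral_le_of_norm_le_const measure_ball_lt_top fun z _ => ?_
      refine (norm_sub_le _ _).trans ?_
      linarith [hM (y + z), hM y]
    · intro y
      simp only [hF]
      rw [mul_right_comm]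
      refine mul_le_mul_of_nonneg_right ?_ (hφ0 _)
      rw [← div_le_iff₀ hJ]
      exact le_max_left _ _
  have hl1 : Tendsto (fun n => L - C * rn n) atTop (𝓝 (L - C * 0)) :=
    (hrnlim.const_mul C).const_sub L
  have := le_of_tendsto_of_tendsto' hl1 (hlim.const_mul N) key
  simpa using this

variable {Φ : Set (Pt d) → Set (Pt d) → Set (Pt d)}

theorem mol_main [Nontrivial (Pt d)] (hax : SumAxioms d Φ)
    (hbulky : ∀ A B, GoodSet A → GoodSet B → Bulky (Φ A B)) {f φ : Pt d → ℝ} (hf : Continuous f)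
    (hfc : HasCompactSupport f) (hφ : ContDiff ℝ ∞ φ) (hφc : HasCompactSupport φ)
    (hφ0 : ∀ y, 0 ≤ φ y) {h k ρ : ℝ} (hφh : Function.support φ ⊆ ball 0 h) (hk : 0 ≤ k)
    (hρ : 0 < ρ) {A B : Set (Pt d)} (hA : GoodSet A) (hB : GoodSet B)
    (H1 : ∀ x ∈ Φ A B, ∀ y, dist x y < h → ∀ z : Pt d, ‖z‖ < ρ →
      f (y + z) + f (y - z) ≤ 2 * f y + 2 * k * ‖z‖ ^ 2)
    (H2 : ∀ x ∈ Φ A B, ∀ y, dist x y < h → ∃ r₀ > 0, ∀ r, 0 < r → r < r₀ → gg f r y ≤ 0) :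
    ∫ y in Φ A B, mol f φ y ≤ (∫ y in A, mol f φ y) + ∫ y in B, mol f φ y := by
  have hN : (0 : ℝ) < Fintype.card (G d) := by exact_mod_cast Fintype.card_pos
  obtain ⟨L, C, hC, HT⟩ := mol_taylor hf hfc hφ hφc
  have hL : ∀ x ∈ Φ A B, L x ≤ 0 := fun x hx =>
    L_nonpos hf hfc hφ.continuous hφc hφ0 hφh hk hρ x (H1 x hx) (H2 x hx) hC (HT x)
  have hQ := sum_good hax hA hB
  have hvc := mol_continuous hf hφ.continuous hφc
  set v := mol f φ with hv
  have hnn : 0 ≤ ∫ y in Φ A B, ‖y‖ ^ 2 := integral_nonneg fun y => by positivity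
  have key : ∀ δ > 0, ∫ y in Φ A B, v y ≤ (∫ y in A, v y) + (∫ y in B, v y) +
      δ * ∫ y in Φ A B, ‖y‖ ^ 2 := by
    intro δ hδ
    have hc2 : Continuous fun y => v y - δ * ‖y‖ ^ 2 := by fun_prop
    have hr : 0 < Fintype.card (G d) * δ / (4 * (C + 1)) := by positivity
    have := main_comb hax hbulky hc2 hQ.2 (half_pos hδ) hr (fun x hx z hz => by
      rw [Finset.sum_sub_distrib, ← Finset.mul_sum, avg_normsq]
      have h1 := (abs_le.1 (HT x z)).2
      have h2 : L x * ‖z‖ ^ 2 ≤ 0 := mul_nonpos_of_nonpos_of_nonneg (hL x hx) (by positivity)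
      have h3 : C * ‖z‖ ^ 3 ≤ Fintype.card (G d) * (δ / 2) * ‖z‖ ^ 2 := by
        have e : C * ‖z‖ ^ 3 = C * ‖z‖ * ‖z‖ ^ 2 := by ring
        rw [e]
        refine mul_le_mul_of_nonneg_right ?_ (by positivity)
        have h4 : (C + 1) * ‖z‖ ≤ (C + 1) * (2 * (Fintype.card (G d) * δ / (4 * (C + 1)))) :=
          mul_le_mul_of_nonneg_left hz (by linarith)
        have h5 : (C + 1) * (2 * (Fintype.card (G d) * δ / (4 * (C + 1)))) =
            Fintype.card (G d) * (δ / 2) := by field_simp; ring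
        have := norm_nonneg z
        nlinarith
      nlinarith) A B hA hB subset_rfl
    have i1 : ∀ S : Set (Pt d), IsBounded S → ∫ y in S, (v y - δ * ‖y‖ ^ 2) =
        (∫ y in S, v y) - δ * ∫ y in S, ‖y‖ ^ 2 := by
      intro S hS
      rw [integral_sub (int_good hvc hS) (int_good (by fun_prop) hS), integral_const_mul]
    rw [i1 _ hQ.2, i1 _ hA.2, i1 _ hB.2] at this
    have p1 : 0 ≤ δ * ∫ y in A, ‖y‖ ^ 2 :=
      mul_nonneg hδ.le (integral_nonneg fun y => by positivity)
    have p2 : 0 ≤ δ * ∫ y in B, ‖y‖ ^ 2 :=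
      mul_nonneg hδ.le (integral_nonneg fun y => by positivity)
    linarith
  apply le_of_forall_pos_le_add
  intro ε hε
  refine (key (ε / ((∫ y in Φ A B, ‖y‖ ^ 2) + 1)) (by positivity)).trans ?_
  gcongr
  rw [div_mul_eq_mul_div, div_le_iff₀ (by positivity)]
  nlinarith

end SumQD
end

section
open MeasureTheory Metric Bornology Filter Topology
open scoped ContDiff

namespace SumQD

variable {d : ℕ}
variable {Φ : Set (Pt d) → Set (Pt d) → Set (Pt d)}

lemma mol_close {f φ : Pt d → ℝ} (hf : Continuous f)
    (hfc : HasCompactSupport f) (hφ : Continuous φ) (hφc : HasCompactSupport φ)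
    (hφ0 : ∀ y, 0 ≤ φ y) {h ε : ℝ} (hφh : Function.support φ ⊆ ball 0 h)
    (hφ1 : ∫ y, φ y = 1) (hε : ∀ x y, dist x y < h → |f y - f x| ≤ ε) (x : Pt d) :
    |mol f φ x - f x| ≤ ε := by
  have hφx : HasCompactSupport fun y => φ (x - y) :=
    hφc.comp_homeomorph (Homeomorph.subLeft x)
  have hφi : Integrable fun y => φ (x - y) :=
    (by fun_prop : Continuous fun y => φ (x - y)).integrable_of_hasCompactSupport hφx
  have h1 : ∫ y, φ (x - y) = 1 := by rw [integral_sub_left_eq_self (fun y => φ y), hφ1]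
  have e : mol f φ x - f x = ∫ y, (f y - f x) * φ (x - y) := by
    simp only [sub_mul]
    rw [integral_sub (int_mul hf hfc (by fun_prop)) (hφi.const_mul _), integral_const_mul, h1,
      mul_one]
    rfl
  rw [e]
  refine (abs_integral_le_integral_abs).trans ?_
  have : ∫ y, ε * φ (x - y) = ε := by rw [integral_const_mul, h1, mul_one]
  rw [← this]
  refine integral_mono_of_nonneg (Eventually.of_forall fun y => abs_nonneg _) (hφi.const_mul _)
    (Eventually.of_forall fun y => ?_)
  simp only
  rw [abs_mul, abs_of_nonneg (hφ0 _)]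
  by_cases hy : φ (x - y) = 0
  · simp [hy]
  · refine mul_le_mul_of_nonneg_right (hε _ _ ?_) (hφ0 _)
    have := hφh (Function.mem_support.2 hy)
    rwa [mem_ball_zero_iff, ← dist_eq_norm] at this

theorem cont_main [Nontrivial (Pt d)] (hax : SumAxioms d Φ)
    (hbulky : ∀ A B, GoodSet A → GoodSet B → Bulky (Φ A B)) {f : Pt d → ℝ} (hf : Continuous f)
    (hfc : HasCompactSupport f) {h k ρ : ℝ} (hh : 0 < h) (hk : 0 ≤ k)
    (hρ : 0 < ρ) {A B : Set (Pt d)} (hA : GoodSet A) (hB : GoodSet B)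
    (H1 : ∀ x ∈ Φ A B, ∀ y, dist x y < h → ∀ z : Pt d, ‖z‖ < ρ →
      f (y + z) + f (y - z) ≤ 2 * f y + 2 * k * ‖z‖ ^ 2)
    (H2 : ∀ x ∈ Φ A B, ∀ y, dist x y < h → ∃ r₀ > 0, ∀ r, 0 < r → r < r₀ → gg f r y ≤ 0) :
    ∫ y in Φ A B, f y ≤ (∫ y in A, f y) + ∫ y in B, f y := by
  have hQ := sum_good hax hA hB
  have hu := hf.uniformContinuous_of_tendsto_cocompact
    (hfc.is_zero_at_infty)
  have key : ∀ ε > 0, ∫ y in Φ A B, f y ≤ (∫ y in A, f y) + (∫ y in B, f y) +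
      ε * (volume.real (Φ A B) + volume.real A + volume.real B) := by
    intro ε hε
    obtain ⟨δ, hδ, hδ'⟩ := Metric.uniformContinuous_iff.1 hu ε hε
    set h' := min h δ with hh'
    have hh0 : 0 < h' := lt_min hh hδ
    let b : ContDiffBump (0 : Pt d) := ⟨h' / 2, h', by linarith, by linarith⟩
    set φ := b.normed volume with hφdef
    have hφ : ContDiff ℝ ∞ φ := b.contDiff_normed
    have hφc : HasCompactSupport φ := b.hasCompactSupport_normed
    have hφ0 : ∀ y, 0 ≤ φ y := b.nonneg_normed
    have hφs : Function.support φ ⊆ ball 0 h' := (b.support_normed_eq (μ := volume)).subset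
    have hφ1 : ∫ y, φ y = 1 := b.integral_normed
    have hm := mol_main hax hbulky hf hfc hφ hφc hφ0 hφs hk hρ hA hB
      (fun x hx y hy => H1 x hx y (hy.trans_le (min_le_left _ _)))
      (fun x hx y hy => H2 x hx y (hy.trans_le (min_le_left _ _)))
    have hcl := mol_close hf hfc hφ.continuous hφc hφ0 hφs hφ1 (ε := ε) (fun x y hxy => by
      have := hδ' (hxy.trans_le (min_le_right _ _))
      rw [dist_comm, Real.dist_eq] at this
      exact this.le)
    have hvc := mol_continuous hf hφ.continuous hφc
    have hS : ∀ S : Set (Pt d), GoodSet S →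
        |(∫ y in S, mol f φ y) - ∫ y in S, f y| ≤ ε * volume.real S := by
      intro S hS
      rw [← integral_sub (int_good hvc hS.2) (int_good hf hS.2)]
      exact norm_setIntegral_le_of_norm_le_const (f := fun y => mol f φ y - f y) (C := ε)
        (good_lt_top hS) fun x _ => hcl x
    have a1 := abs_le.1 (hS _ hQ)
    have a2 := abs_le.1 (hS _ hA)
    have a3 := abs_le.1 (hS _ hB)
    linarith [a1.1, a2.2, a3.2]
  apply le_of_forall_pos_le_add
  intro ε hε
  have hnn : 0 ≤ volume.real (Φ A B) + volume.real A + volume.real B := by positivity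
  refine (key (ε / ((volume.real (Φ A B) + volume.real A + volume.real B) + 1))
    (by positivity)).trans ?_
  gcongr
  rw [div_mul_eq_mul_div, div_le_iff₀ (by positivity)]
  nlinarith

end SumQD
end

section
open MeasureTheory Metric Bornology Filter Topology
open scoped ContDiff

namespace SumQD

variable {d : ℕ}
variable {Φ : Set (Pt d) → Set (Pt d) → Set (Pt d)}

lemma ic_attained {σ : Pt d → ℝ} (hσ : LowerSemicontinuous σ) {m N k ρ : ℝ}
    (hm : ∀ x, m ≤ σ x) (hN : ∀ x, σ x ≤ N) (hk : 0 ≤ k) (hρ : 0 < ρ) (hkρ : N - m ≤ k * ρ ^ 2)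
    (x : Pt d) :
    ∃ p, ‖x - p‖ ≤ ρ ∧ ∀ w, σ p + k * ‖x - p‖ ^ 2 ≤ σ w + k * ‖x - w‖ ^ 2 := by
  have hl : LowerSemicontinuous fun y => σ y + k * ‖x - y‖ ^ 2 :=
    hσ.add (by fun_prop : Continuous fun y => k * ‖x - y‖ ^ 2).lowerSemicontinuous
  obtain ⟨p, hp, hmin⟩ := (hl.lowerSemicontinuousOn (closedBall x ρ)).exists_isMinOn
    ⟨x, mem_closedBall_self hρ.le⟩ (isCompact_closedBall x ρ)
  refine ⟨p, ?_, fun w => ?_⟩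
  · rwa [mem_closedBall, dist_comm, dist_eq_norm] at hp
  · by_cases hw : ‖x - w‖ ≤ ρ
    · have : w ∈ closedBall x ρ := by rwa [mem_closedBall, dist_comm, dist_eq_norm]
      exact hmin this
    · push Not at hw
      have h1 : σ p + k * ‖x - p‖ ^ 2 ≤ σ x + k * ‖x - x‖ ^ 2 := hmin (mem_closedBall_self hρ.le)
      rw [sub_self, norm_zero] at h1
      have h2 : k * ρ ^ 2 ≤ k * ‖x - w‖ ^ 2 := by gcongr
      nlinarith [hm w, hN x]

/-- `f` is the inf-convolution with minimiser selection `p` -/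
structure IC (σ : Pt d → ℝ) (k ρ : ℝ) (f : Pt d → ℝ) (p : Pt d → Pt d) : Prop where
  eq : ∀ x, f x = σ (p x) + k * ‖x - p x‖ ^ 2
  near : ∀ x, ‖x - p x‖ ≤ ρ
  le : ∀ x w, f x ≤ σ w + k * ‖x - w‖ ^ 2

lemma IC.cont {σ : Pt d → ℝ} {k ρ : ℝ} {f : Pt d → ℝ} {p : Pt d → Pt d} (h : IC σ k ρ f p)
    (hk : 0 ≤ k) (hρ : 0 < ρ) : Continuous f := by
  have key : ∀ x x', f x' ≤ f x + k * (2 * ρ * ‖x' - x‖ + ‖x' - x‖ ^ 2) := by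
    intro x x'
    refine (h.le x' (p x)).trans ?_
    rw [h.eq x, add_assoc, ← mul_add]
    gcongr
    have h1 : ‖x' - p x‖ ≤ ‖x - p x‖ + ‖x' - x‖ := by
      calc ‖x' - p x‖ = ‖(x - p x) + (x' - x)‖ := by congr 1; abel
        _ ≤ _ := norm_add_le _ _
    have h2 := h.near x
    have h3 := norm_nonneg (x' - x)
    have h4 := norm_nonneg (x' - p x)
    have h5 := norm_nonneg (x - p x)
    nlinarith
  rw [continuous_iff_continuousAt]
  intro x
  have hc : Continuous fun x' => k * (2 * ρ * ‖x' - x‖ + ‖x' - x‖ ^ 2) := by fun_prop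
  have h0 := hc.tendsto x
  simp only [sub_self, norm_zero] at h0
  have h0' : Tendsto (fun x' => k * (2 * ρ * ‖x' - x‖ + ‖x' - x‖ ^ 2)) (𝓝 x) (𝓝 0) := by
    simpa using h0
  have := squeeze_zero_norm (f := fun x' => f x' - f x) (fun x' => ?_) h0'
  · unfold ContinuousAt
    have := this.add_const (f x)
    simpa using this
  · rw [Real.norm_eq_abs, abs_le]
    constructor
    · have := key x' x
      rw [norm_sub_rev] at this
      linarith
    · linarith [key x x']

lemma IC.semi {σ : Pt d → ℝ} {k ρ : ℝ} {f : Pt d → ℝ} {p : Pt d → Pt d} (h : IC σ k ρ f p)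
    (x z : Pt d) : f (x + z) + f (x - z) ≤ 2 * f x + 2 * k * ‖z‖ ^ 2 := by
  have h1 := h.le (x + z) (p x)
  have h2 := h.le (x - z) (p x)
  have h3 := parallelogram_law_with_norm ℝ (x - p x) z
  rw [show x - p x + z = x + z - p x by abel, show x - p x - z = x - z - p x by abel] at h3
  rw [h.eq x]
  have h4 : k * (‖x + z - p x‖ ^ 2 + ‖x - z - p x‖ ^ 2) =
    k * (2 * (‖x - p x‖ ^ 2 + ‖z‖ ^ 2)) := by rw [h3]
  nlinarith

lemma bdd_int {σ : Pt d → ℝ} (hσ : Measurable σ) {C : ℝ} (hC : ∀ x, |σ x| ≤ C) {S : Set (Pt d)}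
    (hS : IsBounded S) : IntegrableOn σ S := by
  have : IsFiniteMeasure (volume.restrict S) :=
    ⟨by rw [Measure.restrict_apply_univ]; exact hS.measure_lt_top⟩
  exact (integrable_const C).mono' hσ.aestronglyMeasurable (Eventually.of_forall hC)

lemma IC.mean {σ : Pt d → ℝ} {k ρ : ℝ} {f : Pt d → ℝ} {p : Pt d → Pt d} (h : IC σ k ρ f p)
    (hk : 0 ≤ k) (hρ : 0 < ρ) (hσ : Measurable σ) {C : ℝ} (hC : ∀ x, |σ x| ≤ C) (x : Pt d)
    (r : ℝ) : gg f r x ≤ ∫ z in ball (0 : Pt d) r, (σ (p x + z) - σ (p x)) := by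
  have hc := h.cont hk hρ
  refine setIntegral_mono_on (int_good (by fun_prop) isBounded_ball) ?_ isOpen_ball.measurableSet ?_
  · refine bdd_int (C := C + C) ((hσ.comp (measurable_const_add _)).sub_const _)
      (fun z => ?_) isBounded_ball
    exact (abs_sub _ _).trans (add_le_add (hC _) (hC _))
  · intro z _
    have := h.le (x + z) (p x + z)
    rw [show x + z - (p x + z) = x - p x by abel] at this
    rw [h.eq x]
    linarith

lemma inf_step [Nontrivial (Pt d)] (hax : SumAxioms d Φ)
    (hbulky : ∀ A B, GoodSet A → GoodSet B → Bulky (Φ A B)) {σ : Pt d → ℝ}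
    {k η : ℝ} {f : Pt d → ℝ} {p : Pt d → Pt d} (h : IC σ k (η / 4) f p)
    (hk : 0 ≤ k) (hη : 0 < η) (hσ : Measurable σ) {C : ℝ} (hC : ∀ x, |σ x| ≤ C)
    {A B : Set (Pt d)} (hA : GoodSet A) (hB : GoodSet B)
    (H : ∀ x ∈ Φ A B, ∀ y, dist x y < η → ∃ r₀ > 0, ∀ r, 0 < r → r < r₀ →
      ∫ z in ball (0 : Pt d) r, (σ (y + z) - σ y) ≤ 0) :
    ∫ y in Φ A B, f y ≤ (∫ y in A, f y) + ∫ y in B, f y := by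
  have hQ := sum_good hax hA hB
  have hc := h.cont hk (by positivity)
  obtain ⟨R, hR, hR'⟩ := hQ.2.subset_ball_lt 0 0
  let b : ContDiffBump (0 : Pt d) := ⟨R + η, R + η + 1, by linarith, by linarith⟩
  have hb1 : ∀ y : Pt d, ‖y‖ ≤ R + η → b y = 1 := fun y hy =>
    b.one_of_mem_closedBall (by simpa using hy)
  set F : Pt d → ℝ := fun y => f y * b y with hF
  have hFe : ∀ y : Pt d, ‖y‖ ≤ R + η → F y = f y := fun y hy => by simp [hF, hb1 y hy]
  have hn : ∀ x ∈ Φ A B, ‖x‖ < R := fun x hx => by simpa using hR' hx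
  have hny : ∀ x ∈ Φ A B, ∀ y, dist x y < η / 2 → ‖y‖ < R + η / 2 := by
    intro x hx y hy
    have h1 := hn x hx
    rw [dist_comm, dist_eq_norm] at hy
    have : ‖y‖ ≤ ‖y - x‖ + ‖x‖ := by simpa using norm_add_le (y - x) x
    linarith
  have hFc : Continuous F := hc.mul b.continuous
  have hFs : HasCompactSupport F := b.hasCompactSupport.mul_left
  have main := cont_main hax hbulky hFc hFs (h := η / 2) (k := k) (ρ := η / 2)
    (by positivity) hk (by positivity) hA hB ?_ ?_
  · have e : ∀ S : Set (Pt d), GoodSet S → S ⊆ Φ A B → ∫ y in S, F y = ∫ y in S, f y := by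
      intro S hS hS'
      refine setIntegral_congr_fun hS.1.measurableSet fun y hy => hFe y ?_
      linarith [hn y (hS' hy)]
    rwa [e _ hQ subset_rfl, e _ hA (hax.subset_sum _ _ hA hB),
      e _ hB (subset_sum_right hax hA hB)] at main
  · intro x hx y hy z hz
    have h1 := hny x hx y hy
    rw [hFe y (by linarith), hFe (y + z) (by linarith [norm_add_le y z]),
      hFe (y - z) (by linarith [norm_sub_le y z])]
    exact h.semi y z
  · intro x hx y hy
    have h1 := hny x hx y hy
    obtain ⟨r₀, hr₀, hr⟩ := H x hx (p y) (by
      have h2 := h.near y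
      have := dist_triangle x y (p y)
      rw [dist_eq_norm y] at this
      linarith)
    refine ⟨min r₀ (η / 2), lt_min hr₀ (by positivity), fun r hr0 hr1 => ?_⟩
    have e : gg F r y = gg f r y := by
      refine setIntegral_congr_fun isOpen_ball.measurableSet fun z hz => ?_
      have hz' : ‖z‖ < r := by simpa using hz
      have := hr1.trans_le (min_le_right _ _)
      rw [hFe y (by linarith), hFe (y + z) (by linarith [norm_add_le y z])]
    rw [e]
    exact (h.mean hk (by positivity) hσ hC y r).trans
      (hr r hr0 (hr1.trans_le (min_le_left _ _)))

theorem lsc_main [Nontrivial (Pt d)] (hax : SumAxioms d Φ)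
    (hbulky : ∀ A B, GoodSet A → GoodSet B → Bulky (Φ A B)) {σ : Pt d → ℝ}
    (hl : LowerSemicontinuous σ) {m N η : ℝ} (hm : ∀ x, m ≤ σ x) (hN : ∀ x, σ x ≤ N)
    (hη : 0 < η) {A B : Set (Pt d)} (hA : GoodSet A) (hB : GoodSet B)
    (H : ∀ x ∈ Φ A B, ∀ y, dist x y < η → ∃ r₀ > 0, ∀ r, 0 < r → r < r₀ →
      ∫ z in ball (0 : Pt d) r, (σ (y + z) - σ y) ≤ 0) :
    ∫ y in Φ A B, σ y ≤ (∫ y in A, σ y) + ∫ y in B, σ y := by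
  have hQ := sum_good hax hA hB
  have hmN : m ≤ N := (hm 0).trans (hN 0)
  have hσ : Measurable σ := hl.measurable
  have hC : ∀ x, |σ x| ≤ |m| + |N| := fun x => by
    rw [abs_le]
    constructor
    · linarith [hm x, neg_abs_le m, abs_nonneg N]
    · linarith [hN x, le_abs_self N, abs_nonneg m]
  set K : ℕ → ℝ := fun n => (N - m) / (η / 4) ^ 2 + (n + 1) with hK
  have hK0 : ∀ n, 0 < K n := fun n => by
    have : 0 ≤ (N - m) / (η / 4) ^ 2 := div_nonneg (by linarith) (by positivity)
    simp only [hK]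
    positivity
  have hKη : ∀ n, N - m ≤ K n * (η / 4) ^ 2 := fun n => by
    simp only [hK]
    rw [add_mul, div_mul_cancel₀ _ (by positivity)]
    have : 0 ≤ ((n : ℝ) + 1) * (η / 4) ^ 2 := by positivity
    linarith
  have hex := fun n x => ic_attained hl hm hN (hK0 n).le (show 0 < η / 4 by positivity) (hKη n) x
  choose p hp hp' using hex
  set f : ℕ → Pt d → ℝ := fun n x => σ (p n x) + K n * ‖x - p n x‖ ^ 2 with hf
  have hIC : ∀ n, IC σ (K n) (η / 4) (f n) (p n) := fun n => ⟨fun x => rfl, hp n, hp' n⟩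
  have hfσ : ∀ n x, f n x ≤ σ x := fun n x => by
    have := (hIC n).le x x
    simpa using this
  have hfm : ∀ n x, m ≤ f n x := fun n x => by
    simp only [hf]
    have : 0 ≤ K n * ‖x - p n x‖ ^ 2 := mul_nonneg (hK0 n).le (by positivity)
    linarith [hm (p n x)]
  have hstep := fun n => inf_step hax hbulky (hIC n) (hK0 n).le hη hσ hC hA hB H
  have hlim : ∀ x, Tendsto (fun n => f n x) atTop (𝓝 (σ x)) := by
    intro x
    rw [Metric.tendsto_atTop]
    intro ε hε
    have h1 := hl x (σ x - ε) (by linarith)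
    obtain ⟨δ, hδ, hδ'⟩ := Metric.eventually_nhds_iff.1 h1
    obtain ⟨n0, hn0⟩ := exists_nat_gt ((N - m) / δ ^ 2)
    refine ⟨n0, fun n hn => ?_⟩
    have hKn : N - m < K n * δ ^ 2 := by
      rw [div_lt_iff₀ (by positivity)] at hn0
      refine hn0.trans_le (mul_le_mul_of_nonneg_right ?_ (by positivity))
      have : 0 ≤ (N - m) / (η / 4) ^ 2 := div_nonneg (by linarith) (by positivity)
      have : (n0 : ℝ) ≤ n := by exact_mod_cast hn
      simp only [hK]
      linarith
    have h2 : K n * ‖x - p n x‖ ^ 2 < K n * δ ^ 2 := by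
      have h3 := hfσ n x
      simp only [hf] at h3
      linarith [hm (p n x), hN x]
    have h3 : ‖x - p n x‖ ^ 2 < δ ^ 2 := lt_of_mul_lt_mul_left h2 (hK0 n).le
    have h4 : ‖x - p n x‖ < δ := lt_of_pow_lt_pow_left₀ 2 hδ.le h3
    have h5 := hδ' (show dist (p n x) x < δ by rwa [dist_comm, dist_eq_norm])
    have h6 : σ (p n x) ≤ f n x := by
      simp only [hf]
      have : 0 ≤ K n * ‖x - p n x‖ ^ 2 := mul_nonneg (hK0 n).le (by positivity)
      linarith
    rw [Real.dist_eq, abs_lt]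
    constructor
    · linarith
    · linarith [hfσ n x]
  have hDCT : ∀ S : Set (Pt d), GoodSet S →
      Tendsto (fun n => ∫ y in S, f n y) atTop (𝓝 (∫ y in S, σ y)) := by
    intro S hS
    have : IsFiniteMeasure (volume.restrict S) :=
      ⟨by rw [Measure.restrict_apply_univ]; exact good_lt_top hS⟩
    refine tendsto_integral_of_dominated_convergence (fun _ => |m| + |N|)
      (fun n => ((hIC n).cont (hK0 n).le (by positivity)).aestronglyMeasurable)
      (integrable_const _) (fun n => Eventually.of_forall fun x => ?_)
      (Eventually.of_forall hlim)
    rw [Real.norm_eq_abs, abs_le]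
    constructor
    · linarith [hfm n x, neg_abs_le m, abs_nonneg N]
    · linarith [hfσ n x, hN x, le_abs_self N, abs_nonneg m]
  exact le_of_tendsto_of_tendsto' (hDCT _ hQ) ((hDCT _ hA).add (hDCT _ hB)) hstep

end SumQD
end

section
open MeasureTheory Metric Bornology Filter Topology
open scoped ContDiff

namespace SumQD

variable {d : ℕ}
variable {Φ : Set (Pt d) → Set (Pt d) → Set (Pt d)}

lemma shift_ball (g : Pt d → ℝ) (y : Pt d) (r : ℝ) :
    ∫ z in ball (0 : Pt d) r, g (y + z) = ∫ w in ball y r, g w := by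
  have := (measurePreserving_add_left (volume : Measure (Pt d)) y).setIntegral_preimage_emb
    (measurableEmbedding_addLeft y) g (ball y r)
  rw [← this]
  congr 2
  ext z
  simp

lemma mean_min {τ : Pt d → ℝ} {y : Pt d} {r N : ℝ} (hr : 0 < r)
    (hi : IntegrableOn τ (ball y r)) (h : ⨍ w in ball y r, τ w ≤ τ y) :
    ∫ w in ball y r, (min (τ w) N - min (τ y) N) ≤ 0 := by
  have hfin : IsFiniteMeasure (volume.restrict (ball y r)) :=
    ⟨by rw [Measure.restrict_apply_univ]; exact measure_ball_lt_top⟩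
  have hV : 0 < volume.real (ball y r) :=
    ENNReal.toReal_pos (measure_ball_pos _ _ hr).ne' measure_ball_lt_top.ne
  have hmi : Integrable (fun w => min (τ w) N) (volume.restrict (ball y r)) :=
    hi.inf (integrable_const N)
  rw [integral_sub hmi (integrable_const _), setIntegral_const, smul_eq_mul, sub_nonpos]
  rw [setAverage_eq, smul_eq_mul, inv_mul_le_iff₀ hV] at h
  rcases le_total (τ y) N with hc | hc
  · rw [min_eq_left hc]
    exact (integral_mono hmi hi fun w => min_le_left _ _).trans h
  · rw [min_eq_right hc]
    refine (integral_mono hmi (integrable_const N) fun w => min_le_right _ _).trans ?_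
    rw [setIntegral_const, smul_eq_mul]

lemma trunc_main [Nontrivial (Pt d)] (hax : SumAxioms d Φ)
    (hbulky : ∀ A B, GoodSet A → GoodSet B → Bulky (Φ A B)) {τ : Pt d → ℝ} {Q : Set (Pt d)}
    (hQ : IsOpen Q) (hl : LowerSemicontinuousOn τ Q) (hi : IntegrableOn τ Q)
    (hmean : ∀ x ∈ Q, ∃ r₀ > 0, ∀ r, 0 < r → r < r₀ → ⨍ w in ball x r, τ w ≤ τ x)
    {A B : Set (Pt d)} (hA : GoodSet A) (hB : GoodSet B) {η : ℝ} (hη : 0 < η)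
    (hsub : thickening η (Φ A B) ⊆ Q) (N : ℝ) :
    ∫ y in Φ A B, min (τ y) N ≤ (∫ y in A, min (τ y) N) + ∫ y in B, min (τ y) N := by
  classical
  have hg := sum_good hax hA hB
  set K := cthickening (η / 2) (Φ A B) with hK
  have hKc : IsCompact K := isCompact_of_isClosed_isBounded isClosed_cthickening hg.2.cthickening
  have hKQ : K ⊆ Q := (cthickening_subset_thickening' hη (by linarith) _).trans hsub
  have hTK : thickening (η / 2) (Φ A B) ⊆ K := thickening_subset_cthickening _ _
  have hΦK : Φ A B ⊆ K := self_subset_cthickening _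
  set σ : Pt d → ℝ := fun y => if y ∈ K then min (τ y) N else N with hσ
  have hσK : ∀ y ∈ K, σ y = min (τ y) N := fun y hy => by simp [hσ, hy]
  have hσN : ∀ y, σ y ≤ N := fun y => by
    by_cases hy : y ∈ K
    · rw [hσK y hy]; exact min_le_right _ _
    · simp [hσ, hy]
  have hσl : LowerSemicontinuous σ := by
    intro x c hc
    by_cases hx : x ∈ K
    · rw [hσK x hx] at hc
      replace hc := lt_min_iff.1 hc
      have h1 := hl x (hKQ hx) c hc.1
      rw [hQ.nhdsWithin_eq (hKQ hx)] at h1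
      filter_upwards [h1] with y hy
      by_cases hyK : y ∈ K
      · rw [hσK y hyK]; exact lt_min hy hc.2
      · simpa [hσ, hyK] using hc.2
    · have : Kᶜ ∈ 𝓝 x := isClosed_cthickening.isOpen_compl.mem_nhds hx
      filter_upwards [this] with y hy
      have hy' : y ∉ K := hy
      have e1 : σ x = N := by simp [hσ, hx]
      have e2 : σ y = N := by simp [hσ, hy']
      rw [e2, ← e1]; exact hc
  obtain ⟨m0, hm0⟩ := (hl.mono hKQ).bddBelow_of_isCompact hKc
  have hm : ∀ y, min m0 N ≤ σ y := fun y => by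
    by_cases hy : y ∈ K
    · rw [hσK y hy]; exact min_le_min_right _ (hm0 ⟨y, hy, rfl⟩)
    · simp [hσ, hy]
  have main := lsc_main hax hbulky hσl hm hσN (half_pos hη) hA hB ?_
  · have e : ∀ S : Set (Pt d), GoodSet S → S ⊆ Φ A B →
        ∫ y in S, σ y = ∫ y in S, min (τ y) N := fun S hS hS' =>
      setIntegral_congr_fun hS.1.measurableSet fun y hy => hσK y (hΦK (hS' hy))
    rwa [e _ hg subset_rfl, e _ hA (hax.subset_sum _ _ hA hB),
      e _ hB (subset_sum_right hax hA hB)] at main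
  · intro x hx y hy
    have hyT : y ∈ thickening (η / 2) (Φ A B) :=
      mem_thickening_iff.2 ⟨x, hx, by rwa [dist_comm]⟩
    obtain ⟨r₁, hr₁, hb⟩ := Metric.isOpen_iff.1 isOpen_thickening y hyT
    obtain ⟨r₀, hr₀, hr⟩ := hmean y (hKQ (hTK hyT))
    refine ⟨min r₀ r₁, lt_min hr₀ hr₁, fun r h0 h1 => ?_⟩
    have hbK : ball y r ⊆ K :=
      (ball_subset_ball (h1.trans_le (min_le_right _ _)).le).trans (hb.trans hTK)
    rw [shift_ball (fun w => σ w - σ y)]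
    have := mean_min (N := N) h0 (hi.mono_set (hbK.trans hKQ))
      (hr r h0 (h1.trans_le (min_le_left _ _)))
    refine le_trans (le_of_eq ?_) this
    refine setIntegral_congr_fun isOpen_ball.measurableSet fun w hw => ?_
    rw [hσK w (hbK hw), hσK y (hTK hyT)]

lemma trunc_tendsto {τ : Pt d → ℝ} {S : Set (Pt d)} (hi : IntegrableOn τ S) :
    Tendsto (fun N : ℕ => ∫ y in S, min (τ y) N) atTop (𝓝 (∫ y in S, τ y)) := by
  refine tendsto_integral_of_dominated_convergence (fun y => |τ y|) (fun N => ?_) hi.abs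
    (fun N => Eventually.of_forall fun y => ?_) (Eventually.of_forall fun y => ?_)
  · exact hi.1.inf aestronglyMeasurable_const
  · have : (0 : ℝ) ≤ N := Nat.cast_nonneg N
    rw [Real.norm_eq_abs]
    rcases le_total (τ y) N with hc | hc
    · rw [min_eq_left hc]
    · rw [min_eq_right hc, abs_of_nonneg this]
      exact hc.trans (le_abs_self _)
  · refine tendsto_const_nhds.congr' ?_
    obtain ⟨n0, hn0⟩ := exists_nat_ge (τ y)
    filter_upwards [eventually_ge_atTop n0] with n hn
    rw [min_eq_left]
    exact hn0.trans (by exact_mod_cast hn)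

/-- inner parallel set -/
def shr (A : Set (Pt d)) (ε : ℝ) : Set (Pt d) := {y | ∃ ε' > ε, ball y ε' ⊆ A}

lemma mem_shr {A : Set (Pt d)} {ε : ℝ} {y : Pt d} : y ∈ shr A ε ↔ ∃ ε' > ε, ball y ε' ⊆ A :=
  Iff.rfl

lemma shr_open {A : Set (Pt d)} {ε : ℝ} : IsOpen (shr A ε) := by
  rw [Metric.isOpen_iff]
  intro y hy
  obtain ⟨ε', h1, h2⟩ := mem_shr.1 hy
  refine ⟨(ε' - ε) / 2, by linarith, fun w hw => mem_shr.2 ⟨(ε + ε') / 2, by linarith, ?_⟩⟩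
  refine (ball_subset_ball' ?_).trans h2
  rw [mem_ball] at hw
  linarith

lemma shr_subset {A : Set (Pt d)} {ε : ℝ} (hε : 0 ≤ ε) : shr A ε ⊆ A := by
  intro y hy
  obtain ⟨ε', h1, h2⟩ := mem_shr.1 hy
  exact h2 (mem_ball_self (by linarith))

lemma shr_good {A : Set (Pt d)} (hA : GoodSet A) {ε : ℝ} (hε : 0 ≤ ε) : GoodSet (shr A ε) :=
  ⟨shr_open, hA.2.subset (shr_subset hε)⟩

lemma shr_shift {A : Set (Pt d)} {ε : ℝ} {z : Pt d} (hz : ‖z‖ < ε) :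
    (· + z) '' shr A ε ⊆ A := by
  rintro _ ⟨y, hy, rfl⟩
  obtain ⟨ε', h1, h2⟩ := mem_shr.1 hy
  refine h2 ?_
  simp only [mem_ball, dist_self_add_left]
  linarith

lemma shr_anti {A : Set (Pt d)} {ε δ : ℝ} (h : ε ≤ δ) : shr A δ ⊆ shr A ε := by
  intro y hy
  obtain ⟨ε', h1, h2⟩ := mem_shr.1 hy
  exact mem_shr.2 ⟨ε', by linarith, h2⟩

lemma shr_iUnion {A : Set (Pt d)} (hA : IsOpen A) : ⋃ n : ℕ, shr A (1 / ((n : ℝ) + 1)) = A := by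
  apply Set.Subset.antisymm
  · exact Set.iUnion_subset fun n => shr_subset (by positivity)
  · intro y hy
    obtain ⟨ε, hε, h⟩ := Metric.isOpen_iff.1 hA y hy
    obtain ⟨n, hn⟩ := exists_nat_one_div_lt hε
    exact Set.mem_iUnion.2 ⟨n, mem_shr.2 ⟨ε, hn, h⟩⟩

lemma shr_mono (A : Set (Pt d)) : Monotone fun n : ℕ => shr A (1 / ((n : ℝ) + 1)) := by
  intro a b hab
  exact shr_anti (one_div_le_one_div_of_le (by positivity) (by
    have : (a : ℝ) ≤ b := by exact_mod_cast hab
    linarith))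

lemma shr_thick (hax : SumAxioms d Φ) {A B : Set (Pt d)} (hA : GoodSet A) (hB : GoodSet B)
    {ε : ℝ} (hε : 0 ≤ ε) : thickening ε (Φ (shr A ε) (shr B ε)) ⊆ Φ A B := by
  intro y hy
  obtain ⟨x, hx, hxy⟩ := mem_thickening_iff.1 hy
  have hz : ‖y - x‖ < ε := by rwa [← dist_eq_norm]
  have h1 : y ∈ (· + (y - x)) '' Φ (shr A ε) (shr B ε) := ⟨x, hx, by simp⟩
  rw [← hax.translate _ _ _ (shr_good hA hε) (shr_good hB hε)] at h1
  exact mono2 hax (good_image (shr_good hA hε) (IsometryEquiv.addRight (y - x))) hA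
    (good_image (shr_good hB hε) (IsometryEquiv.addRight (y - x))) hB (shr_shift hz)
    (shr_shift hz) h1

theorem real_main [Nontrivial (Pt d)] (hax : SumAxioms d Φ)
    (hbulky : ∀ A B, GoodSet A → GoodSet B → Bulky (Φ A B)) {τ : Pt d → ℝ}
    {A B : Set (Pt d)} (hA : GoodSet A) (hB : GoodSet B)
    (hl : LowerSemicontinuousOn τ (Φ A B)) (hi : IntegrableOn τ (Φ A B))
    (hmean : ∀ x ∈ Φ A B, ∃ r₀ > 0, ∀ r, 0 < r → r < r₀ → ⨍ w in ball x r, τ w ≤ τ x) :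
    ∫ y in Φ A B, τ y ≤ (∫ y in A, τ y) + ∫ y in B, τ y := by
  have hQ := sum_good hax hA hB
  set a : ℕ → Set (Pt d) := fun n => shr A (1 / ((n : ℝ) + 1)) with ha
  set b : ℕ → Set (Pt d) := fun n => shr B (1 / ((n : ℝ) + 1)) with hb
  have hag : ∀ n, GoodSet (a n) := fun n => shr_good hA (by positivity)
  have hbg : ∀ n, GoodSet (b n) := fun n => shr_good hB (by positivity)
  have haA : ∀ n, a n ⊆ A := fun n => shr_subset (by positivity)
  have hbB : ∀ n, b n ⊆ B := fun n => shr_subset (by positivity)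
  set q : ℕ → Set (Pt d) := fun n => Φ (a n) (b n) with hq
  have hqg : ∀ n, GoodSet (q n) := fun n => sum_good hax (hag n) (hbg n)
  have hqQ : ∀ n, q n ⊆ Φ A B := fun n => mono2 hax (hag n) hA (hbg n) hB (haA n) (hbB n)
  have haU : ⋃ n, a n = A := shr_iUnion hA.1
  have hbU : ⋃ n, b n = B := shr_iUnion hB.1
  have ham : Monotone a := shr_mono A
  have hbm : Monotone b := shr_mono B
  have hqm : Monotone q := fun i j hij =>
    mono2 hax (hag i) (hag j) (hbg i) (hbg j) (ham hij) (hbm hij)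
  have hqU : (⋃ n, q n : Set (Pt d)) =ᵐ[volume] Φ A B := by
    refine ae_eq_of_subset (isOpen_iUnion fun n => (hqg n).1).measurableSet
      (Set.iUnion_subset hqQ) ?_ (good_lt_top hQ).ne
    have t1 := tendsto_measure_iUnion_atTop (μ := volume) ham
    have t2 := tendsto_measure_iUnion_atTop (μ := volume) hbm
    rw [haU] at t1
    rw [hbU] at t2
    rw [hax.conserve _ _ hA hB]
    refine le_of_tendsto (t1.add t2) (Eventually.of_forall fun n => ?_)
    have := hax.conserve _ _ (hag n) (hbg n)
    simp only [Function.comp]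
    rw [← this]
    exact measure_mono (Set.subset_iUnion q n)
  have step : ∀ n, ∫ y in q n, τ y ≤ (∫ y in a n, τ y) + ∫ y in b n, τ y := by
    intro n
    have hηp : (0 : ℝ) < 1 / ((n : ℝ) + 1) := by positivity
    have hT := fun N : ℕ => trunc_main hax hbulky hQ.1 hl hi hmean (hag n) (hbg n) hηp
      (shr_thick hax hA hB hηp.le) N
    exact le_of_tendsto_of_tendsto' (trunc_tendsto (hi.mono_set (hqQ n)))
      ((trunc_tendsto (hi.mono_set ((haA n).trans (hax.subset_sum _ _ hA hB)))).add
        (trunc_tendsto (hi.mono_set ((hbB n).trans (subset_sum_right hax hA hB))))) hT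
  have u1 := tendsto_setIntegral_of_monotone (μ := volume) (f := τ)
    (fun n => (hag n).1.measurableSet) ham
    (by rw [haU]; exact hi.mono_set (hax.subset_sum _ _ hA hB))
  have u2 := tendsto_setIntegral_of_monotone (μ := volume) (f := τ)
    (fun n => (hbg n).1.measurableSet) hbm
    (by rw [hbU]; exact hi.mono_set (subset_sum_right hax hA hB))
  have u3 := tendsto_setIntegral_of_monotone (μ := volume) (f := τ)
    (fun n => (hqg n).1.measurableSet) hqm (hi.mono_set (Set.iUnion_subset hqQ))
  rw [haU] at u1
  rw [hbU] at u2
  rw [setIntegral_congr_set hqU] at u3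
  exact le_of_tendsto_of_tendsto' u3 (u1.add u2) step

lemma nontriv (hax : SumAxioms d Φ) : Nontrivial (Pt d) := by
  by_contra h
  rw [not_nontrivial_iff_subsingleton] at h
  have hg : GoodSet (Set.univ : Set (Pt d)) :=
    ⟨isOpen_univ, (Set.subsingleton_univ).finite.isBounded⟩
  have h1 := hax.conserve _ _ hg hg
  have h2 : volume (Set.univ : Set (Pt d)) < ⊤ := good_lt_top hg
  have h3 : 0 < volume (Set.univ : Set (Pt d)) := isOpen_univ.measure_pos _ Set.univ_nonempty
  have h4 := measure_mono (μ := volume) (Set.subset_univ (Φ Set.univ Set.univ))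
  rw [h1] at h4
  exact absurd h4 (not_le.2 (ENNReal.lt_add_right h2.ne h3.ne'))

end SumQD
end

/-- Let ⊕ be a sum of open sets in ℝ^d satisfying the six requirements
exactly and producing bulky sums. Then for all bounded open sets A, B, the set A ⊕ B is a
quadrature domain for 1_A + 1_B: for every s superharmonic and integrable on A ⊕ B,
∫_{A ⊕ B} s ≤ ∫_A s + ∫_B s. -/
theorem sum_is_quadratureDomain (d : ℕ)
    (Φ : Set (Pt d) → Set (Pt d) → Set (Pt d)) (hax : SumAxioms d Φ)
    (hbulky : ∀ A B, GoodSet A → GoodSet B → Bulky (Φ A B))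
    (A B : Set (Pt d)) (hA : GoodSet A) (hB : GoodSet B)
    (s : Pt d → EReal) (hs : SuperharmonicOn s (Φ A B))
    (hint : MeasureTheory.IntegrableOn (fun x => (s x).toReal) (Φ A B) volume) :
    (∫ x in Φ A B, (s x).toReal) ≤ (∫ x in A, (s x).toReal) + ∫ x in B, (s x).toReal := by
  have := SumQD.nontriv hax
  obtain ⟨h1, h2, -, -, h5⟩ := hs
  have hfin : ∀ x ∈ Φ A B, ((s x).toReal : EReal) = s x := by
    intro x hx
    refine EReal.coe_toReal (h1 x hx) ?_
    obtain ⟨r₀, hr₀, hr⟩ := h5 x hx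
    have := hr (r₀ / 2) (by linarith) (by linarith)
    intro hbot
    rw [hbot, le_bot_iff] at this
    exact EReal.coe_ne_bot _ this
  refine SumQD.real_main hax hbulky hA hB ?_ hint ?_
  · intro x hx c hc
    have hc' : (c : EReal) < s x := by
      rw [← hfin x hx]; exact EReal.coe_lt_coe_iff.2 hc
    filter_upwards [h2 x hx c hc', self_mem_nhdsWithin] with y hy hyQ
    rw [← hfin y hyQ] at hy
    exact EReal.coe_lt_coe_iff.1 hy
  · intro x hx
    obtain ⟨r₀, hr₀, hr⟩ := h5 x hx
    refine ⟨r₀, hr₀, fun r h0 hr1 => ?_⟩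
    have := hr r h0 hr1
    rw [← hfin x hx] at this
    exact EReal.coe_le_coe_iff.1 this
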